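/- (Kushnirenko's theorem, solution-count form.) Let m₀, m₁, …, m_s ∈ ℤⁿ be lattice points such that Δ = conv(m₀,…,m_s) ⊂ ℝⁿ has dimension n. Then there exists a nonzero polynomial D in the variables (c_{ij})_{i=1,…,n; j=0,…,s} with the following property: for every choice of coefficients c with D(c) ≠ 0, the system of n equations Σ_{j=0}^s c_{ij}·λ^{m_j} = 0 (i = 1,…,n) has exactly n!·vol(Δ) solutions λ ∈ (ℂˣ)ⁿ, i.e. the solution set is finite of cardinality n!·vol(Δ). -/

import Mathlib

open scoped BigOperators

namespace Kushnirenko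

section Filtration

variable {k L ι : Type*} [Field k] [Field L] [Algebra k L]

theorem sup_span_pow_succ_le (G : Submodule k L) (y : L) (e : ℕ) :
    (G ⊔ Submodule.span k {y}) ^ (e + 1) ≤
      G * (G ⊔ Submodule.span k {y}) ^ e ⊔ Submodule.span k {y ^ (e + 1)} := by
  induction e with
  | zero => simp
  | succ e ih =>
    set W := G ⊔ Submodule.span k {y} with hW
    calc W ^ (e + 1 + 1) = W ^ (e + 1) * G ⊔ W ^ (e + 1) * Submodule.span k {y} := by
          rw [pow_succ W (e + 1), ← Submodule.mul_sup]
      _ ≤ G * W ^ (e + 1) ⊔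
          (G * W ^ e ⊔ Submodule.span k {y ^ (e + 1)}) * Submodule.span k {y} :=
          sup_le_sup (mul_comm _ _).le (mul_le_mul_left ih _)
      _ ≤ _ := by
          rw [Submodule.sup_mul, Submodule.span_mul_span, Set.singleton_mul_singleton, ← pow_succ,
            mul_assoc, pow_succ W e]
          refine sup_le le_sup_left (sup_le_sup_right ?_ _)
          exact mul_le_mul_right (mul_le_mul_right le_sup_right _) _

/-- If `y` satisfies a filtered integral equation over the filtration by powers of `G`, then the
powers of `y` lie in a module of finite type over this filtration. -/
theorem pow_mem_of_filtered_integral {G : Submodule k L} (hG : 1 ≤ G) {y : L} {d : ℕ}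
    (h : y ^ (d + 1) ∈ G * (G ⊔ Submodule.span k {y}) ^ d) (a : ℕ) :
    y ^ a ∈ G ^ a * (G ⊔ Submodule.span k {y}) ^ d := by
  set W := G ⊔ Submodule.span k {y} with hW
  have h1 : W ^ (d + 1) ≤ G * W ^ d := by
    refine (sup_span_pow_succ_le G y d).trans (sup_le le_rfl ?_)
    rwa [Submodule.span_singleton_le_iff_mem]
  have h2 : ∀ a, W ^ (a + d) ≤ G ^ a * W ^ d := by
    intro a
    induction a with
    | zero => simp
    | succ a ih =>
      calc W ^ (a + 1 + d) = W * W ^ (a + d) := by rw [← pow_succ']; congr 1; ring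
        _ ≤ W * (G ^ a * W ^ d) := mul_le_mul_right ih _
        _ = G ^ a * W ^ (d + 1) := by rw [pow_succ W]; ring
        _ ≤ G ^ a * (G * W ^ d) := mul_le_mul_right h1 _
        _ = _ := by rw [pow_succ, mul_assoc]
  have hy : y ^ a ∈ W ^ a := Submodule.pow_mem_pow _
    (Submodule.mem_sup_right (Submodule.mem_span_singleton_self y)) a
  refine h2 a ?_
  have h3 : W ^ a ≤ W ^ (a + d) := pow_le_pow_right' (hG.trans le_sup_left) (by omega)
  exact h3 hy

/-- Elements of `(G + ky) ^ e` of lower degree in `y`. -/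
def lowerPart (G : Submodule k L) (y : L) : ℕ → Submodule k L
  | 0 => ⊥
  | e + 1 => G * (G ⊔ Submodule.span k {y}) ^ e

theorem lowerPart_mul_le (G : Submodule k L) (y : L) (e e' : ℕ) :
    lowerPart G y e * (G ⊔ Submodule.span k {y}) ^ e' ≤ lowerPart G y (e + e') := by
  cases e with
  | zero => simp [lowerPart]
  | succ e =>
    rw [show e + 1 + e' = (e + e') + 1 by ring, lowerPart, lowerPart, mul_assoc, pow_add]

/-- `z` has degree at most `e` in `y` with leading coefficient `a`. -/
def HasLead (G : Submodule k L) (y : L) (e : ℕ) (z : L) (a : k) : Prop :=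
  z ∈ (G ⊔ Submodule.span k {y}) ^ e ∧ z - a • y ^ e ∈ lowerPart G y e

namespace HasLead

variable {G : Submodule k L} {y z z' : L} {e e' : ℕ} {a a' : k}

theorem smul (h : HasLead G y e z a) (b : k) : HasLead G y e (b • z) (b * a) := by
  refine ⟨Submodule.smul_mem _ _ h.1, ?_⟩
  rw [mul_smul, ← smul_sub]
  exact Submodule.smul_mem _ _ h.2

theorem add (h : HasLead G y e z a) (h' : HasLead G y e z' a') :
    HasLead G y e (z + z') (a + a') := by
  refine ⟨Submodule.add_mem _ h.1 h'.1, ?_⟩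
  rw [add_smul, add_sub_add_comm]
  exact Submodule.add_mem _ h.2 h'.2

theorem zero : HasLead G y e 0 0 := by simp [HasLead]

theorem sum {κ : Type*} (s : Finset κ) {z : κ → L} {a : κ → k}
    (h : ∀ i ∈ s, HasLead G y e (z i) (a i)) :
    HasLead G y e (∑ i ∈ s, z i) (∑ i ∈ s, a i) := by
  classical
  induction s using Finset.induction_on with
  | empty => simpa using zero
  | insert i s hi ih =>
    rw [Finset.sum_insert hi, Finset.sum_insert hi]
    exact (h i (by simp)).add (ih fun j hj => h j (by simp [hj]))

theorem mul (h : HasLead G y e z a) (h' : HasLead G y e' z' a') :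
    HasLead G y (e + e') (z * z') (a * a') := by
  refine ⟨by rw [pow_add]; exact Submodule.mul_mem_mul h.1 h'.1, ?_⟩
  have h1 : z * z' - (a * a') • y ^ (e + e') =
      (z - a • y ^ e) * z' + (z' - a' • y ^ e') * (a • y ^ e) := by
    simp only [Algebra.smul_def, map_mul, pow_add]; ring
  rw [h1]
  refine Submodule.add_mem _ (lowerPart_mul_le _ _ _ _ (Submodule.mul_mem_mul h.2 h'.1)) ?_
  rw [add_comm e e']
  refine lowerPart_mul_le _ _ _ _ (Submodule.mul_mem_mul h'.2 (Submodule.smul_mem _ _ ?_))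
  exact Submodule.pow_mem_pow _
    (Submodule.mem_sup_right (Submodule.mem_span_singleton_self y)) e

theorem one : HasLead G y 0 1 1 := by
  refine ⟨by simp, by simp [lowerPart]⟩

theorem pow (h : HasLead G y e z a) (b : ℕ) : HasLead G y (b * e) (z ^ b) (a ^ b) := by
  induction b with
  | zero => simpa using one
  | succ b ih =>
    rw [pow_succ, pow_succ, add_mul, one_mul]
    exact ih.mul h

theorem prod {κ : Type*} (s : Finset κ) {e : κ → ℕ} {z : κ → L} {a : κ → k}
    (h : ∀ i ∈ s, HasLead G y (e i) (z i) (a i)) :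
    HasLead G y (∑ i ∈ s, e i) (∏ i ∈ s, z i) (∏ i ∈ s, a i) := by
  classical
  induction s using Finset.induction_on with
  | empty => simpa using one
  | insert i s hi ih =>
    rw [Finset.sum_insert hi, Finset.prod_insert hi, Finset.prod_insert hi]
    exact (h i (by simp)).mul (ih fun j hj => h j (by simp [hj]))

theorem of_lt (hG : 1 ≤ G) (h : HasLead G y e z a) (he : e < e') : HasLead G y e' z 0 := by
  obtain ⟨f, rfl⟩ : ∃ f, e' = f + 1 := ⟨e' - 1, by omega⟩
  have h1 : z ∈ (G ⊔ Submodule.span k {y}) ^ f :=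
    pow_le_pow_right' (hG.trans le_sup_left) (show e ≤ f by omega) h.1
  have h2 : z ∈ G * (G ⊔ Submodule.span k {y}) ^ f := by
    have := Submodule.mul_mem_mul (hG (Submodule.one_le.mp le_rfl)) h1
    rwa [one_mul] at this
  refine ⟨?_, by simpa [lowerPart] using h2⟩
  rw [pow_succ']
  exact (mul_le_mul_left (le_sup_left (a := G) (b := Submodule.span k {y})) _ :) h2

theorem self : HasLead G y 1 y 1 := by
  refine ⟨by simpa using Submodule.mem_sup_right (Submodule.mem_span_singleton_self y), by simp⟩

end HasLead

/-- The scalars and the elements `g i` span the first step of the degree filtration on `k[g]`. -/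
def degreeOne (k : Type*) {L ι : Type*} [Field k] [Field L] [Algebra k L] (g : ι → L) :
    Submodule k L :=
  1 ⊔ Submodule.span k (Set.range g)

theorem one_le_degreeOne (g : ι → L) : 1 ≤ degreeOne k g := le_sup_left

/-- A generic linear change of coordinates makes an algebraic dependence relation integral, in a
way compatible with degrees. -/
theorem exists_filtered_integral [Fintype ι] {K : Type*} [Field K] [Algebra K k] [Algebra K L]
    [IsScalarTower K k L] {u : ι → k} (hu : AlgebraicIndependent K u) {g' : ι → L} {y : L}
    (hdep : ¬ AlgebraicIndependent K (fun o : Option ι => o.elim y g')) {g : ι → L}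
    (hg : ∀ i, g i = g' i + u i • y) :
    ∃ d, y ^ (d + 1) ∈ degreeOne k g * (degreeOne k g ⊔ Submodule.span k {y}) ^ d := by
  classical
  set G := degreeOne k g with hGdef
  have hG : 1 ≤ G := one_le_degreeOne g
  obtain ⟨p, hp0, hp⟩ : ∃ p : MvPolynomial (Option ι) K,
      MvPolynomial.aeval (fun o : Option ι => o.elim y g') p = 0 ∧ p ≠ 0 := by
    rw [algebraicIndependent_iff] at hdep
    push Not at hdep
    exact hdep
  set d := p.totalDegree with hd
  have hu' : AlgebraicIndependent K (fun i => -u i) := by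
    have := hu
    rw [algebraicIndependent_iff] at this ⊢
    intro q hq
    have h1 := this (MvPolynomial.aeval (fun i => -MvPolynomial.X i) q) (by
      rw [← hq, ← AlgHom.comp_apply]
      congr 1
      ext i
      simp)
    have h2 : MvPolynomial.aeval (fun i => -MvPolynomial.X i)
        (MvPolynomial.aeval (fun i => -MvPolynomial.X (R := K) i) q) = q := by
      rw [← AlgHom.comp_apply]
      conv_rhs => rw [← AlgHom.id_apply (R := K) q]
      congr 1
      ext i
      simp
    rw [← h2, h1, map_zero]
  have hmon : ∀ b : Option ι →₀ ℕ, HasLead G y (b.some.degree + b none)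
      (∏ o, (o.elim y g') ^ b o) (∏ i, (-u i) ^ b (some i)) := by
    intro b
    rw [Fintype.prod_option, add_comm, ← one_mul (∏ i, (-u i) ^ b (some i))]
    refine HasLead.mul ?_ ?_
    · simpa using (HasLead.self (G := G) (y := y)).pow (b none)
    · have : b.some.degree = ∑ i, b (some i) * 1 := by
        rw [Finsupp.degree_eq_sum]; simp
      rw [this]
      refine HasLead.prod _ fun i _ => HasLead.pow ?_ _
      have hgi : g i ∈ G := Submodule.mem_sup_right (Submodule.subset_span ⟨i, rfl⟩)
      have hg'i : g' i = g i + (-u i) • y := by rw [hg]; simp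
      refine ⟨?_, ?_⟩
      · simp only [Option.elim_some, pow_one]
        rw [hg'i]
        exact Submodule.add_mem _ (Submodule.mem_sup_left hgi) (Submodule.mem_sup_right
          (Submodule.smul_mem _ _ (Submodule.mem_span_singleton_self y)))
      · simp only [Option.elim_some, lowerPart, pow_zero, mul_one, pow_one]
        rw [hg'i, add_sub_cancel_right]
        exact hgi
  have hdeg : ∀ b : Option ι →₀ ℕ, b.degree = b.some.degree + b none := by
    intro b
    rw [Finsupp.degree_eq_sum, Finsupp.degree_eq_sum, Fintype.sum_option, add_comm]
    simp
  set q : MvPolynomial ι K := ∑ b ∈ p.support with b.degree = d,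
    MvPolynomial.monomial b.some (p.coeff b) with hq
  have hq0 : q ≠ 0 := by
    obtain ⟨b, hb, hbd⟩ : ∃ b ∈ p.support, b.degree = d := by
      obtain ⟨b, hb, h⟩ := Finset.exists_mem_eq_sup p.support
        (MvPolynomial.support_nonempty.mpr hp) (fun s => s.sum fun _ e => e)
      exact ⟨b, hb, by rw [hd, MvPolynomial.totalDegree, h]; rfl⟩
    intro h
    have h1 : q.coeff b.some = p.coeff b := by
      rw [hq, MvPolynomial.coeff_sum]
      rw [Finset.sum_eq_single b]
      · simp
      · intro c hc hcb
        rw [MvPolynomial.coeff_monomial, if_neg]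
        intro hcs
        apply hcb
        simp only [Finset.mem_filter] at hc
        have h2 := hdeg b
        have h3 := hdeg c
        rw [hcs] at h3
        ext o
        cases o with
        | none => omega
        | some i => exact DFunLike.congr_fun hcs i
      · intro hb'
        exact absurd (Finset.mem_filter.mpr ⟨hb, hbd⟩) hb'
    rw [h] at h1
    simp at h1 hb
    exact hb h1.symm
  have hlead : HasLead G y d 0 (MvPolynomial.aeval (fun i => -u i) q) := by
    have h1 : HasLead G y d (∑ b ∈ p.support, algebraMap K k (p.coeff b) •
        ∏ o, (o.elim y g') ^ b o) (∑ b ∈ p.support, if b.degree = d then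
          algebraMap K k (p.coeff b) * ∏ i, (-u i) ^ b (some i) else 0) := by
      refine HasLead.sum _ fun b hb => ?_
      have hb' := (hmon b).smul (algebraMap K k (p.coeff b))
      rw [← hdeg] at hb'
      split_ifs with hbd
      · rwa [hbd] at hb'
      · refine hb'.of_lt hG (lt_of_le_of_ne ?_ hbd)
        exact MvPolynomial.le_totalDegree hb
    convert h1 using 1
    · rw [← hp0, MvPolynomial.aeval_eq_eval₂Hom, MvPolynomial.coe_eval₂Hom,
        MvPolynomial.eval₂_eq']
      refine Finset.sum_congr rfl fun b _ => ?_
      rw [Algebra.smul_def, ← IsScalarTower.algebraMap_apply]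
    · rw [hq, map_sum, Finset.sum_filter]
      refine Finset.sum_congr rfl fun b _ => ?_
      split_ifs with hbd
      · rw [MvPolynomial.aeval_monomial, Finsupp.prod_fintype _ _ (by simp)]
        rfl
      · rfl
  have ha : MvPolynomial.aeval (fun i => -u i) q ≠ 0 := fun h =>
    hq0 (hu'.eq_zero_of_aeval_eq_zero _ h)
  have hy : y ^ d ∈ lowerPart G y d := by
    have h1 := hlead.2
    rw [zero_sub, neg_mem_iff] at h1
    have h2 := Submodule.smul_mem _ (MvPolynomial.aeval (fun i => -u i) q)⁻¹ h1
    rwa [smul_smul, inv_mul_cancel₀ ha, one_smul] at h2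
  rcases hd' : d with _ | d'
  · rw [hd'] at hy
    simp [lowerPart] at hy
  · rw [hd'] at hy
    exact ⟨d', hy⟩

end Filtration

section Monomials

/-- The Laurent monomial with exponent `r`. -/
def mon {n : ℕ} {M : Type*} [CommGroup M] (x : Fin n → M) (r : Fin n → ℤ) : M := ∏ l, x l ^ r l

variable {n : ℕ} {M : Type*} [CommGroup M] (x : Fin n → M)

theorem mon_add (r r' : Fin n → ℤ) : mon x (r + r') = mon x r * mon x r' := by
  simp [mon, zpow_add, Finset.prod_mul_distrib]

theorem mon_zero : mon x 0 = 1 := by simp [mon]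

theorem mon_nsmul (t : ℕ) (r : Fin n → ℤ) : mon x (t • r) = mon x r ^ t := by
  induction t with
  | zero => simp [mon_zero]
  | succ t ih => rw [succ_nsmul, mon_add, ih, pow_succ]

theorem mon_sum {κ : Type*} (s : Finset κ) (r : κ → Fin n → ℤ) :
    mon x (∑ j ∈ s, r j) = ∏ j ∈ s, mon x (r j) := by
  classical
  induction s using Finset.induction_on with
  | empty => simp [mon_zero]
  | insert i s hi ih => rw [Finset.sum_insert hi, Finset.prod_insert hi, mon_add, ih]

theorem mon_single (l : Fin n) : mon x (Pi.single l 1) = x l := by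
  rw [mon, Finset.prod_eq_single l]
  · simp
  · intro b _ hb; simp [Pi.single_eq_of_ne hb]
  · simp

theorem map_mon {M' : Type*} [CommGroup M'] (f : M →* M') (r : Fin n → ℤ) :
    f (mon x r) = mon (fun l => f (x l)) r := by
  simp [mon, map_prod]

end Monomials

section Points

variable {n s : ℕ} (v : Fin s → Fin n → ℤ)

/-- The lattice points of the `d`-th dilate of the convex hull of the origin and the points
`v j`. -/
def latticePts (d : ℕ) : Set (Fin n → ℤ) :=
  {r | ∃ a : Fin s → ℝ, (∀ j, 0 ≤ a j) ∧ ∑ j, a j ≤ d ∧ ∀ l, (r l : ℝ) = ∑ j, a j * v j l}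

theorem zero_mem_latticePts (d : ℕ) : (0 : Fin n → ℤ) ∈ latticePts v d :=
  ⟨0, by simp, by simp, by simp⟩

theorem self_mem_latticePts (j : Fin s) : v j ∈ latticePts v 1 := by
  refine ⟨Pi.single j 1, fun i => ?_, by simp, fun l => ?_⟩
  · by_cases h : i = j
    · subst h; simp
    · simp [Pi.single_eq_of_ne h]
  · rw [Finset.sum_eq_single j]
    · simp
    · intro b _ hb; simp [Pi.single_eq_of_ne hb]
    · simp

variable {v}

theorem add_mem_latticePts {d d' : ℕ} {r r' : Fin n → ℤ} (h : r ∈ latticePts v d)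
    (h' : r' ∈ latticePts v d') : r + r' ∈ latticePts v (d + d') := by
  obtain ⟨a, ha, had, har⟩ := h
  obtain ⟨a', ha', had', har'⟩ := h'
  refine ⟨a + a', fun j => add_nonneg (ha j) (ha' j), ?_, fun l => ?_⟩
  · simp only [Pi.add_apply, Finset.sum_add_distrib]; push_cast; linarith
  · simp only [Pi.add_apply, add_mul, Finset.sum_add_distrib]; push_cast; rw [har, har']

theorem latticePts_mono {d d' : ℕ} (h : d ≤ d') : latticePts v d ⊆ latticePts v d' := by
  rintro r ⟨a, ha, had, har⟩
  exact ⟨a, ha, had.trans (by exact_mod_cast h), har⟩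

theorem abs_le_of_mem_latticePts {d : ℕ} {r : Fin n → ℤ} (h : r ∈ latticePts v d) (l : Fin n) :
    |r l| ≤ d * ∑ j, |v j l| := by
  obtain ⟨a, ha, had, har⟩ := h
  have h1 : |(r l : ℝ)| ≤ d * ∑ j, |(v j l : ℝ)| := by
    rw [har]
    refine (Finset.abs_sum_le_sum_abs _ _).trans ?_
    rw [Finset.mul_sum]
    refine Finset.sum_le_sum fun j _ => ?_
    rw [abs_mul, abs_of_nonneg (ha j)]
    refine mul_le_mul_of_nonneg_right ?_ (abs_nonneg _)
    exact (Finset.single_le_sum (fun i _ => ha i) (Finset.mem_univ j)).trans had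
  exact_mod_cast h1

theorem finite_latticePts (d : ℕ) : (latticePts v d).Finite := by
  refine (Set.finite_Icc (fun l => -(d * ∑ j, |v j l|)) (fun l => d * ∑ j, |v j l|)).subset ?_
  intro r hr
  exact ⟨fun l => (abs_le.mp (abs_le_of_mem_latticePts hr l)).1,
    fun l => (abs_le.mp (abs_le_of_mem_latticePts hr l)).2⟩

/-- Finitely many lattice points can be translated simultaneously into the cone over the
points `v j`. -/
theorem exists_add_mem_latticePts
    (hv : Submodule.span ℝ (Set.range fun j (l : Fin n) => (v j l : ℝ)) = ⊤)
    {κ : Type*} [Finite κ] (r : κ → Fin n → ℤ) :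
    ∃ (e : ℕ) (w : Fin n → ℤ), ∀ i, r i + w ∈ latticePts v e := by
  have h1 : ∀ i, ∃ t : Fin s → ℝ, ∑ j, t j • (fun l => (v j l : ℝ)) = fun l => (r i l : ℝ) := by
    intro i
    have : (fun l => (r i l : ℝ)) ∈ Submodule.span ℝ
      (Set.range fun j (l : Fin n) => (v j l : ℝ)) := by rw [hv]; trivial
    exact (Submodule.mem_span_range_iff_exists_fun ℝ).mp this
  choose t ht using h1
  obtain ⟨T, hT⟩ : ∃ T : ℕ, ∀ i j, |t i j| ≤ T := by
    obtain ⟨B, hB⟩ := (Set.finite_range fun p : κ × Fin s => |t p.1 p.2|).bddAbove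
    obtain ⟨T, hT⟩ := exists_nat_ge B
    exact ⟨T, fun i j => (hB ⟨(i, j), rfl⟩).trans hT⟩
  refine ⟨s * (2 * T), ∑ j, T • v j, fun i => ⟨fun j => t i j + T, fun j => ?_, ?_, fun l => ?_⟩⟩
  · have := (abs_le.mp (hT i j)).1
    linarith
  · calc ∑ j, (t i j + T) ≤ ∑ j : Fin s, (2 * T : ℝ) := by
          refine Finset.sum_le_sum fun j _ => ?_
          have := (abs_le.mp (hT i j)).2
          linarith
      _ = _ := by simp
  · have := congrFun (ht i) l
    simp only [Finset.sum_apply, Pi.smul_apply, smul_eq_mul] at this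
    simp only [Pi.add_apply, Finset.sum_apply, Pi.smul_apply, add_mul, Finset.sum_add_distrib]
    rw [Int.cast_add, ← this]
    simp

end Points

theorem fg_one_submodule {k L : Type*} [Field k] [Field L] [Algebra k L] :
    (1 : Submodule k L).FG := by
  rw [Submodule.one_eq_span]
  exact Submodule.fg_span_singleton 1

section Spans

variable {k L : Type*} [Field k] [Field L] [Algebra k L] {n s : ℕ}
  (x : Fin n → Lˣ) (v : Fin s → Fin n → ℤ)

/-- The span of the Laurent monomials with exponents in the `d`-th dilate. -/
def monSpan (k : Type*) {L : Type*} [Field k] [Field L] [Algebra k L] {n s : ℕ}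
    (x : Fin n → Lˣ) (v : Fin s → Fin n → ℤ) (d : ℕ) : Submodule k L :=
  Submodule.span k ((fun r => ((mon x r : Lˣ) : L)) '' latticePts v d)

theorem monSpan_mul_le (d d' : ℕ) :
    monSpan k x v d * monSpan k x v d' ≤ monSpan k x v (d + d') := by
  rw [monSpan, monSpan, Submodule.span_mul_span]
  refine Submodule.span_mono ?_
  rintro _ ⟨_, ⟨r, hr, rfl⟩, _, ⟨r', hr', rfl⟩, rfl⟩
  exact ⟨r + r', add_mem_latticePts hr hr', by simp [mon_add]⟩

theorem one_le_monSpan (d : ℕ) : 1 ≤ monSpan k x v d := by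
  rw [Submodule.one_le]
  exact Submodule.subset_span ⟨0, zero_mem_latticePts v d, by simp [mon_zero]⟩

instance (d : ℕ) : FiniteDimensional k (monSpan k x v d) :=
  FiniteDimensional.span_of_finite k ((finite_latticePts d).image _)

variable {x v}

/-- The monomials with exponents in the dilates form a module of finite type over the filtered
algebra `k[g]`, as soon as the generating monomials satisfy filtered integral equations. -/
theorem exists_monSpan_le {G : Submodule k L} (hG : 1 ≤ G) [FiniteDimensional k G]
    (hintegral : ∀ j, ∃ d, ((mon x (v j) : Lˣ) : L) ^ (d + 1) ∈
      G * (G ⊔ Submodule.span k {((mon x (v j) : Lˣ) : L)}) ^ d) :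
    ∃ Z : Submodule k L, Z.FG ∧ ∀ d, monSpan k x v d ≤ Z * G ^ d := by
  classical
  choose D hD using hintegral
  have hGfg : G.FG := Module.Finite.iff_fg.mp inferInstance
  set Y : Fin s → Submodule k L :=
    fun j => (G ⊔ Submodule.span k {((mon x (v j) : Lˣ) : L)}) ^ D j with hY
  set B : Set (Fin n → ℤ) := Set.Icc (fun l => -∑ j, |v j l|) (fun l => ∑ j, |v j l|) with hB
  set X : Submodule k L := Submodule.span k ((fun r => ((mon x r : Lˣ) : L)) '' B) with hX
  have hYfg : (∏ j, Y j).FG := by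
    refine Finset.prod_induction _ (fun N : Submodule k L => N.FG) (fun a b => Submodule.FG.mul)
      fg_one_submodule fun j _ => ?_
    exact Submodule.FG.pow (hGfg.sup (Submodule.fg_span_singleton _)) _
  refine ⟨X * ∏ j, Y j, ?_, fun d => ?_⟩
  · exact Submodule.FG.mul (Submodule.fg_span ((Set.finite_Icc _ _).image _)) hYfg
  · rw [monSpan, Submodule.span_le]
    rintro _ ⟨r, ⟨a, ha, had, har⟩, rfl⟩
    set N : Fin s → ℕ := fun j => ⌊a j⌋₊ with hN
    have hr : r = (r - ∑ j, N j • v j) + ∑ j, N j • v j := by simp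
    have hNd : ∑ j, N j ≤ d := by
      have : (∑ j, N j : ℝ) ≤ d :=
        (Finset.sum_le_sum fun j _ => Nat.floor_le (ha j)).trans had
      exact_mod_cast this
    have hbound : ∀ l, |(r - ∑ j, N j • v j) l| ≤ ∑ j, |v j l| := by
      intro l
      have h1 : (((r - ∑ j, N j • v j) l : ℤ) : ℝ) = ∑ j, (a j - N j) * v j l := by
        simp [sub_mul, Finset.sum_sub_distrib, har]
      have h2 : |(((r - ∑ j, N j • v j) l : ℤ) : ℝ)| ≤ ∑ j, |(v j l : ℝ)| := by
        rw [h1]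
        refine (Finset.abs_sum_le_sum_abs _ _).trans (Finset.sum_le_sum fun j _ => ?_)
        rw [abs_mul]
        refine mul_le_of_le_one_left (abs_nonneg _) ?_
        rw [abs_le]
        have h3 := Nat.floor_le (ha j)
        have h4 := Nat.lt_floor_add_one (a j)
        constructor <;> simp only [hN] <;> linarith
      exact_mod_cast h2
    have h1 : ((mon x (r - ∑ j, N j • v j) : Lˣ) : L) ∈ X := by
      refine Submodule.subset_span ⟨_, ?_, rfl⟩
      exact ⟨fun l => (abs_le.mp (hbound l)).1, fun l => (abs_le.mp (hbound l)).2⟩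
    have h2 : ∀ s' : Finset (Fin s), (∏ j ∈ s', ((mon x (v j) : Lˣ) : L) ^ N j) ∈
        ∏ j ∈ s', (G ^ N j * Y j) := by
      intro s'
      induction s' using Finset.induction_on with
      | empty => simp
      | insert i s' hi ih =>
        rw [Finset.prod_insert hi, Finset.prod_insert hi]
        exact Submodule.mul_mem_mul (pow_mem_of_filtered_integral hG (hD i) _) ih
    have h3 : ((mon x r : Lˣ) : L) ∈ X * ∏ j, (G ^ N j * Y j) := by
      rw [hr, mon_add, mon_sum, Units.val_mul, Units.coe_prod]
      simp only [mon_nsmul, Units.val_pow_eq_pow_val]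
      exact Submodule.mul_mem_mul h1 (h2 _)
    rw [Finset.prod_mul_distrib, Finset.prod_pow_eq_pow_sum] at h3
    have h4 : X * ((G ^ ∑ j, N j) * ∏ j, Y j) ≤ X * (∏ j, Y j) * G ^ d := by
      rw [mul_comm (G ^ _), ← mul_assoc]
      exact mul_le_mul_right (pow_le_pow_right' hG hNd) _
    exact h4 h3

end Spans

section Degree

variable {k L : Type*} [Field k] [Field L] [Algebra k L]

theorem mem_degreeOne {ι : Type*} (g : ι → L) (i : ι) : g i ∈ degreeOne k g :=
  Submodule.mem_sup_right (Submodule.subset_span ⟨i, rfl⟩)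

instance {ι : Type*} [Finite ι] (g : ι → L) : FiniteDimensional k (degreeOne k g) := by
  have : (degreeOne k g).FG :=
    Submodule.FG.sup fg_one_submodule (Submodule.fg_span (Set.finite_range g))
  exact Module.Finite.iff_fg.mpr this

/-- The exponents of total degree at most `e`. -/
noncomputable def degreeLE (n e : ℕ) : Finset (Fin n →₀ ℕ) :=
  (Finset.finsuppAntidiag (Finset.univ : Finset (Option (Fin n))) e).image Finsupp.some

theorem mem_degreeLE {n e : ℕ} {b : Fin n →₀ ℕ} : b ∈ degreeLE n e ↔ b.degree ≤ e := by
  have hsum : ∀ c : Option (Fin n) →₀ ℕ, ∑ o, c o = c none + c.some.degree := by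
    intro c
    rw [Fintype.sum_option, Finsupp.degree_eq_sum]
    simp
  simp only [degreeLE, Finset.mem_image, Finset.mem_finsuppAntidiag, Finset.subset_univ, and_true]
  constructor
  · rintro ⟨c, hc, rfl⟩
    have := hsum c
    change ∑ o, c o = e at hc
    omega
  · intro hb
    refine ⟨b.optionElim (e - b.degree), ?_, ?_⟩
    · change ∑ o, b.optionElim (e - b.degree) o = e
      rw [hsum]
      simp
      omega
    · simp

theorem card_degreeLE (n e : ℕ) : (degreeLE n e).card = (e + n).choose n := by
  rw [degreeLE, Finset.card_image_of_injOn]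
  · rw [Finset.card_finsuppAntidiag_nat_eq_choose]
    · simp
      rw [add_comm]
      exact Nat.choose_symm_add
  · intro c hc c' hc' h
    simp only [Finset.mem_coe, Finset.mem_finsuppAntidiag] at hc hc'
    have h1 := hc.1
    have h2 := hc'.1
    rw [Fintype.sum_option] at h1 h2
    have h3 : ∀ i, c (some i) = c' (some i) := fun i => DFunLike.congr_fun h i
    simp only [h3] at h1
    ext o
    cases o with
    | none => omega
    | some i => exact h3 i

theorem prod_pow_mem {n : ℕ} {V : ℕ → Submodule k L} (hV : ∀ a b, V a * V b ≤ V (a + b))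
    (h1 : ∀ a, 1 ≤ V a) {g : Fin n → L} (hg : ∀ i, g i ∈ V 1) (b : Fin n →₀ ℕ) :
    ∏ i, g i ^ b i ∈ V b.degree := by
  have hpow : ∀ i t, g i ^ t ∈ V t := by
    intro i t
    induction t with
    | zero => simpa using Submodule.one_le.mp (h1 0)
    | succ t ih => rw [pow_succ]; exact hV _ _ (Submodule.mul_mem_mul ih (hg i))
  rw [Finsupp.degree_eq_sum]
  have : ∀ S : Finset (Fin n), ∏ i ∈ S, g i ^ b i ∈ V (∑ i ∈ S, b i) := by
    classical
    intro S
    induction S using Finset.induction_on with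
    | empty => simpa using Submodule.one_le.mp (h1 0)
    | insert i S hi ih =>
      rw [Finset.sum_insert hi, Finset.prod_insert hi]
      exact hV _ _ (Submodule.mul_mem_mul (hpow _ _) ih)
  exact this _

theorem finrank_degreeOne_pow_le {n : ℕ} (g : Fin n → L) (e : ℕ) :
    Module.finrank k (degreeOne k g ^ e : Submodule k L) ≤ (e + n).choose n := by
  classical
  have h : degreeOne k g ^ e ≤ Submodule.span k
      (((degreeLE n e).image fun b => ∏ i, g i ^ b i : Finset L) : Set L) := by
    induction e with
    | zero =>
      rw [pow_zero, Submodule.one_le]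
      refine Submodule.subset_span ?_
      simp only [Finset.coe_image]
      exact ⟨0, by simp [mem_degreeLE], by simp⟩
    | succ e ih =>
      rw [pow_succ]
      refine (mul_le_mul_left ih _).trans ?_
      rw [degreeOne, Submodule.mul_sup, mul_one, Submodule.span_mul_span]
      refine sup_le (Submodule.span_mono ?_) (Submodule.span_mono ?_)
      · simp only [Finset.coe_image]
        refine Set.image_mono fun b hb => ?_
        simp only [Finset.mem_coe, mem_degreeLE] at hb ⊢
        omega
      · rintro _ ⟨a, ha, _, ⟨i, rfl⟩, rfl⟩
        simp only [Finset.coe_image, Set.mem_image, Finset.mem_coe, mem_degreeLE] at ha ⊢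
        obtain ⟨b, hb, rfl⟩ := ha
        refine ⟨b + Finsupp.single i 1, ?_, ?_⟩
        · simp; omega
        · simp only [Finsupp.add_apply, pow_add, Finset.prod_mul_distrib]
          congr 1
          rw [Finset.prod_eq_single i]
          · simp
          · intro j _ hj; simp [hj.symm]
          · simp
  have : FiniteDimensional k (Submodule.span k
      (((degreeLE n e).image fun b => ∏ i, g i ^ b i : Finset L) : Set L)) :=
    FiniteDimensional.span_finset k _
  refine (Submodule.finrank_mono h).trans ((finrank_span_finset_le_card _).trans ?_)
  exact Finset.card_image_le.trans (card_degreeLE n e).le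

end Degree

theorem finrank_submodule_mul_le {k L : Type*} [Field k] [Field L] [Algebra k L]
    (A B : Submodule k L) [FiniteDimensional k A] [FiniteDimensional k B] :
    Module.finrank k (A * B : Submodule k L) ≤ Module.finrank k A * Module.finrank k B := by
  rw [← Module.finrank_tensorProduct]
  exact LinearMap.finrank_le_finrank_of_surjective (Submodule.mulMap'_surjective A B)

section Extension

variable {k F L : Type*} [Field k] [Field F] [Field L] [Algebra k F] [Algebra F L] [Algebra k L]
  [IsScalarTower k F L] {n s : ℕ} {x : Fin n → Lˣ} {v : Fin s → Fin n → ℤ} {g : Fin n → F}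

theorem isAlgebraic_of_filtered_integral
    (hv : Submodule.span ℝ (Set.range fun j (l : Fin n) => (v j l : ℝ)) = ⊤)
    (hintegral : ∀ j, ∃ d, ((mon x (v j) : Lˣ) : L) ^ (d + 1) ∈
      degreeOne k (fun i => algebraMap F L (g i)) *
        (degreeOne k (fun i => algebraMap F L (g i)) ⊔
          Submodule.span k {((mon x (v j) : Lˣ) : L)}) ^ d) (l : Fin n) :
    IsAlgebraic F (x l : L) := by
  set G := degreeOne k (fun i => algebraMap F L (g i)) with hG
  obtain ⟨Z, hZ, hZG⟩ := exists_monSpan_le (one_le_degreeOne _) hintegral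
  have hGF : ∀ d, ∀ z ∈ G ^ d, z ∈ Set.range (algebraMap F L) := by
    have h1 : G ≤ Subalgebra.toSubmodule ((Algebra.ofId F L).range.restrictScalars k) := by
      refine sup_le ?_ (Submodule.span_le.mpr ?_)
      · rw [Submodule.one_le]
        exact ⟨1, map_one _⟩
      · rintro _ ⟨i, rfl⟩
        exact ⟨g i, rfl⟩
    intro d z hz
    have h2 := pow_le_pow_left' h1 d hz
    have h3 : Subalgebra.toSubmodule ((Algebra.ofId F L).range.restrictScalars k) ^ d ≤
        Subalgebra.toSubmodule ((Algebra.ofId F L).range.restrictScalars k) := by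
      clear h2 hz
      induction d with
      | zero => rw [pow_zero, Submodule.one_le]; exact ⟨1, map_one _⟩
      | succ d ih =>
        rw [pow_succ, Submodule.mul_le]
        intro a ha b hb
        exact ((Algebra.ofId F L).range.restrictScalars k).mul_mem (ih ha) hb
    exact h3 h2
  set N : Submodule F L := Submodule.span F (Z : Set L) with hN
  have hNfg : N.FG := by
    obtain ⟨S, hS⟩ := hZ
    refine ⟨S, le_antisymm (Submodule.span_mono ?_) (Submodule.span_le.mpr ?_)⟩
    · rw [← hS]; exact Submodule.subset_span
    · rw [← hS]
      have : Submodule.span k (S : Set L) ≤ (Submodule.span F (S : Set L)).restrictScalars k :=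
        Submodule.span_le.mpr Submodule.subset_span
      exact this
  have hmemN : ∀ d, ∀ r ∈ latticePts v d, ((mon x r : Lˣ) : L) ∈ N := by
    intro d r hr
    have h1 := hZG d (Submodule.subset_span ⟨r, hr, rfl⟩)
    have h2 : Z * G ^ d ≤ N.restrictScalars k := by
      rw [Submodule.mul_le]
      intro z hz a ha
      obtain ⟨f, rfl⟩ := hGF d a ha
      rw [mul_comm, ← Algebra.smul_def]
      exact Submodule.smul_mem _ _ (Submodule.subset_span hz)
    exact h2 h1
  set N' : Submodule F L :=
    Submodule.span F ((fun r => ((mon x r : Lˣ) : L)) '' ⋃ d, latticePts v d) with hN'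
  have hN'fg : N'.FG := by
    have : FiniteDimensional F N := Module.Finite.iff_fg.mpr hNfg
    have hle : N' ≤ N := by
      rw [hN', Submodule.span_le]
      rintro _ ⟨r, hr, rfl⟩
      obtain ⟨d, hd⟩ := Set.mem_iUnion.mp hr
      exact hmemN d r hd
    exact Module.Finite.iff_fg.mp (Submodule.finiteDimensional_of_le hle)
  have halg : ∀ d, ∀ r ∈ latticePts v d, IsAlgebraic F ((mon x r : Lˣ) : L) := by
    intro d r hr
    refine IsIntegral.isAlgebraic
      (isIntegral_of_smul_mem_submodule (M := L) N' ?_ hN'fg _ fun z hz => ?_)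
    · intro h
      have h1 : (1 : L) ∈ N' := Submodule.subset_span
        ⟨0, Set.mem_iUnion.mpr ⟨0, zero_mem_latticePts v 0⟩, by simp [mon_zero]⟩
      rw [h] at h1
      simp at h1
    · rw [smul_eq_mul]
      induction hz using Submodule.span_induction with
      | mem z hz =>
        obtain ⟨r', hr', rfl⟩ := hz
        obtain ⟨d', hd'⟩ := Set.mem_iUnion.mp hr'
        exact Submodule.subset_span
          ⟨r + r', Set.mem_iUnion.mpr ⟨d + d', add_mem_latticePts hr hd'⟩, by simp [mon_add]⟩
      | zero => simp
      | add a b _ _ ha hb => rw [mul_add]; exact Submodule.add_mem _ ha hb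
      | smul f a _ ha => rw [mul_smul_comm]; exact Submodule.smul_mem _ _ ha
  obtain ⟨e, w, hw⟩ := exists_add_mem_latticePts hv
    (fun b : Bool => if b then (Pi.single l 1 : Fin n → ℤ) else 0)
  have h1 := halg e _ (hw true)
  have h2 := halg e _ (hw false)
  simp only [if_true, Bool.false_eq_true, if_false, zero_add] at h1 h2
  have h3 : (x l : L) = ((mon x (Pi.single l 1 + w) : Lˣ) : L) * ((mon x w : Lˣ) : L)⁻¹ := by
    rw [mon_add, mon_single]
    simp
  rw [h3]
  exact h1.mul h2.inv

theorem adjoin_eq_top_of_tower (hL : IntermediateField.adjoin k (Set.range fun l => (x l : L)) = ⊤) :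
    IntermediateField.adjoin F (Set.range fun l => (x l : L)) = ⊤ := by
  rw [eq_top_iff]
  intro z _
  have h1 : IntermediateField.adjoin k (Set.range fun l => (x l : L)) ≤
      (IntermediateField.adjoin F (Set.range fun l => (x l : L))).restrictScalars k := by
    rw [IntermediateField.adjoin_le_iff]
    exact IntermediateField.subset_adjoin F _
  rw [hL] at h1
  exact h1 (x := z) trivial

theorem finiteDimensional_of_filtered_integral
    (hv : Submodule.span ℝ (Set.range fun j (l : Fin n) => (v j l : ℝ)) = ⊤)
    (hL : IntermediateField.adjoin k (Set.range fun l => (x l : L)) = ⊤)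
    (hintegral : ∀ j, ∃ d, ((mon x (v j) : Lˣ) : L) ^ (d + 1) ∈
      degreeOne k (fun i => algebraMap F L (g i)) *
        (degreeOne k (fun i => algebraMap F L (g i)) ⊔
          Submodule.span k {((mon x (v j) : Lˣ) : L)}) ^ d) :
    FiniteDimensional F L := by
  have h1 : FiniteDimensional F (IntermediateField.adjoin F (Set.range fun l => (x l : L))) := by
    refine IntermediateField.finiteDimensional_adjoin ?_
    rintro _ ⟨l, rfl⟩
    exact (isAlgebraic_of_filtered_integral hv hintegral l).isIntegral
  rw [adjoin_eq_top_of_tower hL] at h1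
  exact IntermediateField.topEquiv.toLinearEquiv.finiteDimensional

theorem finrank_monSpan (hx : LinearIndependent k (fun r : Fin n → ℤ => ((mon x r : Lˣ) : L)))
    (d : ℕ) : Module.finrank k (monSpan k x v d) = (latticePts v d).ncard := by
  have h1 := (hx.comp (Subtype.val : latticePts v d → _) Subtype.val_injective)
  have := (finite_latticePts (v := v) d).fintype
  have h2 := finrank_span_eq_card h1
  rw [monSpan, Set.image_eq_range, Set.ncard_eq_toFinset_card', Set.toFinset_card]
  exact h2

set_option maxHeartbeats 1000000 in
/-- The degree of the extension bounds the number of lattice points from above. -/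
theorem ncard_latticePts_le [FiniteDimensional F L]
    (hx : LinearIndependent k (fun r : Fin n → ℤ => ((mon x r : Lˣ) : L)))
    (hfrac : ∀ z : F, ∃ p ∈ Algebra.adjoin k (Set.range g), ∃ q ∈ Algebra.adjoin k (Set.range g),
      q ≠ 0 ∧ z * q = p)
    (hintegral : ∀ j, ∃ d, ((mon x (v j) : Lˣ) : L) ^ (d + 1) ∈
      degreeOne k (fun i => algebraMap F L (g i)) *
        (degreeOne k (fun i => algebraMap F L (g i)) ⊔
          Submodule.span k {((mon x (v j) : Lˣ) : L)}) ^ d) :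
    ∃ D, ∀ d, (latticePts v d).ncard ≤ Module.finrank F L * (d + D + n).choose n := by
  classical
  set g' : Fin n → L := fun i => algebraMap F L (g i) with hg'
  set G := degreeOne k g' with hG
  obtain ⟨Z, hZ, hZG⟩ := exists_monSpan_le (one_le_degreeOne _) hintegral
  have hadj : ∀ z ∈ Algebra.adjoin k (Set.range g), ∃ e, algebraMap F L z ∈ G ^ e := by
    have hmono : ∀ {a b : ℕ}, a ≤ b → G ^ a ≤ G ^ b :=
      fun h => pow_le_pow_right' (one_le_degreeOne _) h
    intro z hz
    induction hz using Algebra.adjoin_induction with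
    | mem z hz =>
      obtain ⟨i, rfl⟩ := hz
      exact ⟨1, by rw [pow_one]; exact mem_degreeOne g' i⟩
    | algebraMap a =>
      refine ⟨0, ?_⟩
      rw [← IsScalarTower.algebraMap_apply, pow_zero]
      exact Submodule.algebraMap_mem a
    | add a b _ _ ha hb =>
      obtain ⟨e, he⟩ := ha
      obtain ⟨f, hf⟩ := hb
      refine ⟨e + f, ?_⟩
      rw [map_add]
      exact Submodule.add_mem _ (hmono (by omega) he) (hmono (by omega) hf)
    | mul a b _ _ ha hb =>
      obtain ⟨e, he⟩ := ha
      obtain ⟨f, hf⟩ := hb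
      refine ⟨e + f, ?_⟩
      rw [map_mul, pow_add]
      exact Submodule.mul_mem_mul he hf
  set b := Module.finBasis F L with hb
  obtain ⟨S, hS⟩ := hZ
  have hden : ∀ S : Finset F, ∃ q ∈ Algebra.adjoin k (Set.range g), q ≠ 0 ∧
      ∀ z ∈ S, z * q ∈ Algebra.adjoin k (Set.range g) := by
    intro S
    induction S using Finset.induction_on with
    | empty => exact ⟨1, one_mem _, one_ne_zero, by simp⟩
    | insert z S hz ih =>
      obtain ⟨q, hq, hq0, hqS⟩ := ih
      obtain ⟨p, hp, q', hq', hq'0, h⟩ := hfrac z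
      refine ⟨q * q', mul_mem hq hq', mul_ne_zero hq0 hq'0, ?_⟩
      intro w hw
      rcases Finset.mem_insert.mp hw with rfl | hw
      · rw [mul_left_comm, h]; exact mul_mem hq hp
      · rw [← mul_assoc]; exact mul_mem (hqS w hw) hq'
  obtain ⟨q, -, hq0, hqS⟩ := hden
    ((S ×ˢ (Finset.univ : Finset (Fin (Module.finrank F L)))).image fun p => b.repr p.1 p.2)
  choose! E hE using hadj
  set D := ∑ p ∈ S ×ˢ (Finset.univ : Finset (Fin (Module.finrank F L))), E (b.repr p.1 p.2 * q)
    with hD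
  set B : Submodule k L := Submodule.span k (Set.range b) with hB
  have hBfg : FiniteDimensional k B := FiniteDimensional.span_of_finite k (Set.finite_range _)
  have hqZ : Submodule.span k {algebraMap F L q} * Z ≤ B * G ^ D := by
    rw [← hS, Submodule.span_mul_span, Submodule.span_le]
    rintro _ ⟨_, rfl, z, hz, rfl⟩
    change algebraMap F L q * z ∈ B * G ^ D
    rw [← b.sum_repr z, Finset.mul_sum]
    refine Submodule.sum_mem _ fun i _ => ?_
    rw [Algebra.smul_def, ← mul_assoc, ← map_mul, mul_comm (algebraMap F L _) (b i), mul_comm q]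
    have hbi : b i ∈ B := Submodule.subset_span (Set.mem_range_self i)
    refine Submodule.mul_mem_mul hbi ?_
    have hmem : (z, i) ∈ S ×ˢ (Finset.univ : Finset (Fin (Module.finrank F L))) := by
      simpa using hz
    have h0 : b.repr z i ∈ (S ×ˢ (Finset.univ : Finset (Fin (Module.finrank F L)))).image
        fun p => b.repr p.1 p.2 := Finset.mem_image.mpr ⟨(z, i), hmem, rfl⟩
    have h1 := hE _ (hqS _ h0)
    have h2 : E (b.repr z i * q) ≤ D := by
      rw [hD]
      exact Finset.single_le_sum (f := fun p : L × Fin (Module.finrank F L) =>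
        E (b.repr p.1 p.2 * q)) (fun _ _ => Nat.zero_le _) hmem
    exact pow_le_pow_right' (one_le_degreeOne _) h2 h1
  refine ⟨D, fun d => ?_⟩
  rw [← finrank_monSpan hx]
  have hle : Submodule.span k {algebraMap F L q} * monSpan k x v d ≤ B * G ^ (d + D) := by
    calc _ ≤ Submodule.span k {algebraMap F L q} * (Z * G ^ d) := mul_le_mul_right (hZG d) _
      _ = Submodule.span k {algebraMap F L q} * Z * G ^ d := (mul_assoc _ _ _).symm
      _ ≤ B * G ^ D * G ^ d := mul_le_mul_left hqZ _
      _ = _ := by rw [mul_assoc, ← pow_add, add_comm]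
  have hmap : (monSpan k x v d).map (LinearMap.mulLeft k (algebraMap F L q)) ≤ B * G ^ (d + D) := by
    refine le_trans ?_ hle
    rintro _ ⟨z, hz, rfl⟩
    exact Submodule.mul_mem_mul (Submodule.mem_span_singleton_self _) hz
  have hinj : Function.Injective (LinearMap.mulLeft k (algebraMap F L q)) :=
    mul_right_injective₀ (by simpa using hq0)
  have hGfin : FiniteDimensional k (G ^ (d + D) : Submodule k L) :=
    Module.Finite.iff_fg.mpr (Submodule.FG.pow (Module.Finite.iff_fg.mp inferInstance) _)
  have hfin : FiniteDimensional k (B * G ^ (d + D) : Submodule k L) :=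
    Module.Finite.iff_fg.mpr (Submodule.FG.mul (Module.Finite.iff_fg.mp hBfg)
      (Module.Finite.iff_fg.mp hGfin))
  have h1 := Submodule.finrank_mono hmap
  rw [(Submodule.equivMapOfInjective _ hinj _).symm.finrank_eq] at h1
  refine h1.trans ((finrank_submodule_mul_le B (G ^ (d + D))).trans ?_)
  refine Nat.mul_le_mul ?_ (finrank_degreeOne_pow_le _ _)
  exact (finrank_range_le_card b).trans (by simp)

/-- The degree of the extension bounds the number of lattice points from below. -/
theorem le_ncard_latticePts [FiniteDimensional F L]
    (hv : Submodule.span ℝ (Set.range fun j (l : Fin n) => (v j l : ℝ)) = ⊤)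
    (hx : LinearIndependent k (fun r : Fin n → ℤ => ((mon x r : Lˣ) : L)))
    (hL : IntermediateField.adjoin k (Set.range fun l => (x l : L)) = ⊤)
    (hg : AlgebraicIndependent k g)
    (hgx : ∀ i, algebraMap F L (g i) ∈
      Submodule.span k (Set.range fun j => ((mon x (v j) : Lˣ) : L))) :
    ∃ e, ∀ d, Module.finrank F L * (d + n).choose n ≤ (latticePts v (d + e)).ncard := by
  classical
  have hspan : ⊤ ≤ Submodule.span F (Set.range fun r : Fin n → ℤ => ((mon x r : Lˣ) : L)) := by
    have h1 := IntermediateField.adjoin_eq_top_iff.mp (adjoin_eq_top_of_tower (F := F) hL)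
    have h2 : (Submodule.span F (Submonoid.closure (Set.range fun l => (x l : L)) : Set L)) = ⊤ := by
      rw [← Algebra.adjoin_eq_span, h1, Algebra.top_toSubmodule]
    rw [← h2]
    refine Submodule.span_mono ?_
    intro z hz
    induction hz using Submonoid.closure_induction with
    | mem z hz =>
      obtain ⟨l, rfl⟩ := hz
      exact ⟨Pi.single l 1, by simp [mon_single]⟩
    | one => exact ⟨0, by simp [mon_zero]⟩
    | mul a b _ _ ha hb =>
      obtain ⟨r, rfl⟩ := ha
      obtain ⟨r', rfl⟩ := hb
      exact ⟨r + r', by simp [mon_add]⟩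
  obtain ⟨κ, r, b, hbr⟩ : ∃ (κ : Type _) (r : κ → Fin n → ℤ) (b : Module.Basis κ F L),
      ∀ i, b i = ((mon x (r i) : Lˣ) : L) := by
    have h := fun i => Module.Basis.ofSpan_subset hspan ⟨i, rfl⟩
    choose r hr using h
    exact ⟨_, r, Module.Basis.ofSpan hspan, fun i => (hr i).symm⟩
  have hfinκ : Finite κ := Module.Finite.finite_basis b
  have := Fintype.ofFinite κ
  obtain ⟨e, w, hw⟩ := exists_add_mem_latticePts hv r
  refine ⟨e, fun d => ?_⟩
  rw [← finrank_monSpan (x := x) hx]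
  have hli : LinearIndependent k (fun β : degreeLE n d => ∏ i, g i ^ (β : Fin n →₀ ℕ) i) := by
    have h1 := (MvPolynomial.basisMonomials (Fin n) k).linearIndependent.map'
      (MvPolynomial.aeval (R := k) g).toLinearMap (LinearMap.ker_eq_bot.mpr hg)
    have h2 := h1.comp (Subtype.val : degreeLE n d → _) Subtype.val_injective
    have h3 : (fun β : degreeLE n d => ∏ i, g i ^ (β : Fin n →₀ ℕ) i) =
        ((MvPolynomial.aeval (R := k) g).toLinearMap ∘ MvPolynomial.basisMonomials (Fin n) k) ∘
          (Subtype.val : degreeLE n d → _) := by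
      ext β
      simp [MvPolynomial.aeval_monomial, Finsupp.prod_fintype]
    rw [h3]
    exact h2
  have hli2 := linearIndependent_smul hli b.linearIndependent
  have hli3 := hli2.map' (LinearMap.mulLeft k ((mon x w : Lˣ) : L))
    (LinearMap.ker_eq_bot.mpr (mul_right_injective₀ (Units.ne_zero _)))
  have hg1 : ∀ i, algebraMap F L (g i) ∈ monSpan k x v 1 := by
    intro i
    refine Submodule.span_mono ?_ (hgx i)
    rintro _ ⟨j, rfl⟩
    exact ⟨v j, self_mem_latticePts v j, rfl⟩
  have hmem : ∀ p : degreeLE n d × κ, (LinearMap.mulLeft k ((mon x w : Lˣ) : L))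
      ((∏ i, g i ^ (p.1 : Fin n →₀ ℕ) i) • b p.2) ∈ monSpan k x v (d + e) := by
    intro p
    have h1 := prod_pow_mem (monSpan_mul_le x v) (one_le_monSpan x v) hg1 (p.1 : Fin n →₀ ℕ)
    have h2 : ((mon x (r p.2 + w) : Lˣ) : L) ∈ monSpan k x v e :=
      Submodule.subset_span ⟨_, hw p.2, rfl⟩
    have h3 := monSpan_mul_le x v _ _ (Submodule.mul_mem_mul h1 h2)
    have h4 : monSpan k x v ((p.1 : Fin n →₀ ℕ).degree + e) ≤ monSpan k x v (d + e) := by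
      refine Submodule.span_mono (Set.image_mono (latticePts_mono ?_))
      have := mem_degreeLE.mp p.1.2
      omega
    convert h4 h3 using 1
    rw [LinearMap.mulLeft_apply, Algebra.smul_def, hbr, mon_add, Units.val_mul, map_prod]
    simp only [map_pow]
    ring
  have hli4 : LinearIndependent k (fun p : degreeLE n d × κ =>
      (⟨_, hmem p⟩ : monSpan k x v (d + e))) :=
    LinearIndependent.of_comp (monSpan k x v (d + e)).subtype hli3
  have h5 := hli4.fintype_card_le_finrank
  rw [Fintype.card_prod, Fintype.card_coe, card_degreeLE, ← Module.finrank_eq_card_basis b] at h5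
  rwa [mul_comm]

end Extension

section Volume

open scoped Pointwise

variable {n s : ℕ} {v : Fin s → Fin n → ℤ}

theorem convexHull_insert_zero_eq (w : Fin s → Fin n → ℝ) :
    convexHull ℝ (insert 0 (Set.range w)) =
      {z | ∃ a : Fin s → ℝ, (∀ j, 0 ≤ a j) ∧ ∑ j, a j ≤ 1 ∧ z = ∑ j, a j • w j} := by
  classical
  apply Set.Subset.antisymm
  · refine convexHull_min ?_ ?_
    · rintro _ (rfl | ⟨j, rfl⟩)
      · exact ⟨0, by simp, by simp, by simp⟩
      · refine ⟨Pi.single j 1, fun i => ?_, by simp, ?_⟩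
        · by_cases h : i = j
          · subst h; simp
          · simp [Pi.single_eq_of_ne h]
        · rw [Finset.sum_eq_single j]
          · simp
          · intro b _ hb; simp [Pi.single_eq_of_ne hb]
          · simp
    · rintro _ ⟨a, ha, ha1, rfl⟩ _ ⟨b, hb, hb1, rfl⟩ p q hp hq hpq
      refine ⟨fun j => p * a j + q * b j, fun j => ?_, ?_, ?_⟩
      · have := ha j; have := hb j; positivity
      · rw [Finset.sum_add_distrib, ← Finset.mul_sum, ← Finset.mul_sum]
        nlinarith
      · simp only [Finset.smul_sum, add_smul, Finset.sum_add_distrib, mul_smul]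
  · rintro _ ⟨a, ha, ha1, rfl⟩
    refine mem_convexHull_of_exists_fintype
      (fun o : Option (Fin s) => o.elim (1 - ∑ j, a j) a) (fun o => o.elim 0 w) ?_ ?_ ?_ ?_
    · rintro (_ | j)
      · simpa using ha1
      · exact ha j
    · simp [Fintype.sum_option]
    · rintro (_ | j)
      · exact Or.inl rfl
      · exact Or.inr ⟨j, rfl⟩
    · simp [Fintype.sum_option]

theorem card_inter_lattice_eq {d : ℕ} (hd : 0 < d) :
    Nat.card ↑(convexHull ℝ (insert 0 (Set.range fun j (l : Fin n) => (v j l : ℝ))) ∩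
      (d : ℝ)⁻¹ • (Submodule.span ℤ (Set.range (Pi.basisFun ℝ (Fin n))) : Set (Fin n → ℝ))) =
      (latticePts v d).ncard := by
  have hd' : (d : ℝ) ≠ 0 := by positivity
  rw [← Nat.card_coe_set_eq]
  symm
  set f : (Fin n → ℤ) → (Fin n → ℝ) := fun r => (d : ℝ)⁻¹ • fun l => (r l : ℝ) with hf
  have hfinj : Function.Injective f := by
    intro r r' h
    have h1 := smul_right_injective (Fin n → ℝ) (inv_ne_zero hd') h
    ext l
    exact_mod_cast congrFun h1 l
  have himg : f '' latticePts v d =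
      convexHull ℝ (insert 0 (Set.range fun j (l : Fin n) => (v j l : ℝ))) ∩
      (d : ℝ)⁻¹ • (Submodule.span ℤ (Set.range (Pi.basisFun ℝ (Fin n))) : Set (Fin n → ℝ)) := by
    rw [convexHull_insert_zero_eq]
    ext z
    constructor
    · rintro ⟨r, ⟨a, ha, had, har⟩, rfl⟩
      refine ⟨⟨fun j => (d : ℝ)⁻¹ * a j, fun j => mul_nonneg (by positivity) (ha j), ?_, ?_⟩, ?_⟩
      · rw [← Finset.mul_sum]
        exact (inv_mul_le_one₀ (by positivity)).mpr had
      · ext l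
        simp [hf, har, Finset.mul_sum, mul_assoc]
      · refine Set.smul_mem_smul_set ?_
        rw [SetLike.mem_coe, Module.Basis.mem_span_iff_repr_mem]
        intro l
        exact ⟨r l, by simp⟩
    · rintro ⟨⟨a, ha, ha1, rfl⟩, hz⟩
      rw [Set.mem_inv_smul_set_iff₀ hd', SetLike.mem_coe, Module.Basis.mem_span_iff_repr_mem] at hz
      choose r hr using hz
      have hr' : ∀ l, (r l : ℝ) = d * ∑ j, a j * v j l := by
        intro l
        have := hr l
        simpa using this
      refine ⟨r, ⟨fun j => d * a j, fun j => mul_nonneg (by positivity) (ha j), ?_, ?_⟩, ?_⟩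
      · rw [← Finset.mul_sum]
        nlinarith [(Nat.cast_nonneg d : (0 : ℝ) ≤ d)]
      · intro l
        rw [hr', Finset.mul_sum]
        simp [mul_assoc]
      · ext l
        simp only [hf, Pi.smul_apply, smul_eq_mul, hr', Finset.sum_apply]
        field_simp
  rw [← himg]
  exact Nat.card_congr (Equiv.Set.image f _ hfinj)

theorem tendsto_ncard_latticePts :
    Filter.Tendsto (fun d : ℕ => ((latticePts v d).ncard : ℝ) / (d : ℝ) ^ n) Filter.atTop
      (nhds (MeasureTheory.volume.real
        (convexHull ℝ (insert 0 (Set.range fun j (l : Fin n) => (v j l : ℝ)))))) := by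
  have hfin : (insert 0 (Set.range fun j (l : Fin n) => (v j l : ℝ))).Finite :=
    (Set.finite_range _).insert 0
  have h := tendsto_card_div_pow_atTop_volume
    (convexHull ℝ (insert 0 (Set.range fun j (l : Fin n) => (v j l : ℝ))))
    (hfin.isCompact_convexHull ℝ).isBounded (hfin.isClosed_convexHull ℝ).measurableSet
    ((convex_convexHull ℝ _).addHaar_frontier _)
  refine h.congr' ?_
  filter_upwards [Filter.eventually_gt_atTop 0] with d hd
  rw [card_inter_lattice_eq hd, Fintype.card_fin]

theorem tendsto_add_div_pow (c : ℕ) (n : ℕ) :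
    Filter.Tendsto (fun d : ℕ => (((d + c : ℕ) : ℝ) / d) ^ n) Filter.atTop (nhds 1) := by
  have h1 : Filter.Tendsto (fun d : ℕ => ((d + c : ℕ) : ℝ) / d) Filter.atTop (nhds 1) := by
    have h2 := (tendsto_const_div_atTop_nhds_zero_nat (c : ℝ)).const_add 1
    rw [add_zero] at h2
    refine h2.congr' ?_
    filter_upwards [Filter.eventually_gt_atTop 0] with d hd
    have : (d : ℝ) ≠ 0 := by positivity
    push_cast
    field_simp
  simpa using h1.pow n

/-- Sandwiching the number of lattice points of the dilates determines the volume. -/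
theorem eq_factorial_mul_volume {N : ℕ}
    (hup : ∃ D, ∀ d, (latticePts v d).ncard ≤ N * (d + D + n).choose n)
    (hlow : ∃ e, ∀ d, N * (d + n).choose n ≤ (latticePts v (d + e)).ncard) :
    (N : ℝ) = n.factorial * MeasureTheory.volume.real
      (convexHull ℝ (insert 0 (Set.range fun j (l : Fin n) => (v j l : ℝ)))) := by
  obtain ⟨D, hD⟩ := hup
  obtain ⟨e, he⟩ := hlow
  have hlim := (tendsto_ncard_latticePts (v := v)).const_mul (n.factorial : ℝ)
  apply le_antisymm
  · have h1 : Filter.Tendsto (fun d : ℕ => (N : ℝ) * ((((d + e : ℕ) : ℝ) / d) ^ n)⁻¹) Filter.atTop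
        (nhds N) := by
      simpa using ((tendsto_add_div_pow e n).inv₀ one_ne_zero).const_mul (N : ℝ)
    refine le_of_tendsto_of_tendsto h1 (hlim.comp (Filter.tendsto_add_atTop_nat e)) ?_
    filter_upwards [Filter.eventually_gt_atTop 0] with d hd
    have h2 : d ^ n ≤ n.factorial * (d + n).choose n := by
      rw [← Nat.descFactorial_eq_factorial_mul_choose]
      refine le_trans (Nat.pow_le_pow_left ?_ n) (Nat.pow_sub_le_descFactorial (d + n) n)
      omega
    have h3 : (N : ℝ) * (d : ℝ) ^ n ≤ n.factorial * (latticePts v (d + e)).ncard := by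
      have h4 := he d
      have h5 : N * d ^ n ≤ n.factorial * (latticePts v (d + e)).ncard :=
        calc N * d ^ n ≤ N * (n.factorial * (d + n).choose n) := Nat.mul_le_mul_left _ h2
          _ = n.factorial * (N * (d + n).choose n) := by ring
          _ ≤ _ := Nat.mul_le_mul_left _ h4
      exact_mod_cast h5
    have hde : (0 : ℝ) < ((d + e : ℕ) : ℝ) ^ n := by positivity
    rw [div_pow, inv_div, ← mul_div_assoc, Function.comp_apply, ← mul_div_assoc]
    exact div_le_div_of_nonneg_right h3 hde.le
  · have h1 : Filter.Tendsto (fun d : ℕ => (N : ℝ) * (((d + (D + n) : ℕ) : ℝ) / d) ^ n)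
        Filter.atTop (nhds N) := by
      simpa using (tendsto_add_div_pow (D + n) n).const_mul (N : ℝ)
    refine le_of_tendsto_of_tendsto hlim h1 ?_
    filter_upwards [Filter.eventually_gt_atTop 0] with d hd
    have h2 : n.factorial * (d + D + n).choose n ≤ (d + (D + n)) ^ n := by
      rw [← Nat.descFactorial_eq_factorial_mul_choose, ← add_assoc]
      exact Nat.descFactorial_le_pow _ _
    have h3 : (n.factorial : ℝ) * (latticePts v d).ncard ≤ N * ((d + (D + n) : ℕ) : ℝ) ^ n := by
      have h5 : n.factorial * (latticePts v d).ncard ≤ N * (d + (D + n)) ^ n :=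
        calc _ ≤ n.factorial * (N * (d + D + n).choose n) := Nat.mul_le_mul_left _ (hD d)
          _ = N * (n.factorial * (d + D + n).choose n) := by ring
          _ ≤ _ := Nat.mul_le_mul_left _ h2
      exact_mod_cast h5
    rw [div_pow, ← mul_div_assoc, ← mul_div_assoc]
    exact div_le_div_of_nonneg_right h3 (by positivity)

theorem span_sub_eq_top {m : Fin (s + 1) → Fin n → ℤ}
    (hdim : affineSpan ℝ (Set.range fun j : Fin (s + 1) => fun l : Fin n => ((m j l : ℤ) : ℝ)) = ⊤) :
    Submodule.span ℝ (Set.range fun (j : Fin s) (l : Fin n) => ((m j.succ - m 0) l : ℝ)) = ⊤ := by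
  have h1 := congrArg AffineSubspace.direction hdim
  rw [direction_affineSpan, AffineSubspace.direction_top,
    vectorSpan_range_eq_span_range_vsub_right ℝ _ 0] at h1
  rw [eq_top_iff, ← h1, Submodule.span_le]
  rintro _ ⟨j, rfl⟩
  refine Fin.cases ?_ (fun j => ?_) j
  · simp
  · refine Submodule.subset_span ⟨j, ?_⟩
    ext l
    simp

theorem volume_convexHull_sub (m : Fin (s + 1) → Fin n → ℤ) :
    MeasureTheory.volume
      (convexHull ℝ (Set.range fun j : Fin (s + 1) => fun l : Fin n => ((m j l : ℤ) : ℝ))) =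
    MeasureTheory.volume (convexHull ℝ
      (insert 0 (Set.range fun (j : Fin s) (l : Fin n) => ((m j.succ - m 0) l : ℝ)))) := by
  have h : (Set.range fun j : Fin (s + 1) => fun l : Fin n => ((m j l : ℤ) : ℝ)) =
      (fun l => (m 0 l : ℝ)) +ᵥ
        insert 0 (Set.range fun (j : Fin s) (l : Fin n) => ((m j.succ - m 0) l : ℝ)) := by
    rw [Set.vadd_set_insert, ← Set.range_vadd]
    ext z
    simp only [Set.mem_range, Set.mem_insert_iff, Fin.exists_fin_succ]
    refine or_congr ?_ (exists_congr fun j => ?_)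
    · rw [eq_comm]; simp
    · refine Eq.congr_left ?_
      ext l
      simp
  rw [h, convexHull_vadd, MeasureTheory.measure_vadd]

end Volume

section GenericFibre

variable {P E Ω : Type*} [CommRing P] [Field E] [Algebra P E] [Field Ω]

/-- The elements of `E` which lie in the subalgebra `R` after multiplication by a power of `D`. -/
def awaySubalgebra (R : Subalgebra P E) (D : P) : Subalgebra P E where
  carrier := {z | ∃ t : ℕ, D ^ t • z ∈ R}
  mul_mem' := by
    rintro a b ⟨t, ht⟩ ⟨t', ht'⟩
    refine ⟨t + t', ?_⟩
    rw [pow_add, ← smul_mul_smul_comm]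
    exact R.mul_mem ht ht'
  add_mem' := by
    rintro a b ⟨t, ht⟩ ⟨t', ht'⟩
    refine ⟨t + t', ?_⟩
    rw [smul_add]
    refine R.add_mem ?_ ?_
    · rw [pow_add, mul_comm, mul_smul]; exact R.smul_mem ht _
    · rw [pow_add, mul_smul]; exact R.smul_mem ht' _
  algebraMap_mem' r := ⟨0, by simp⟩

theorem le_awaySubalgebra (R : Subalgebra P E) (D : P) : R ≤ awaySubalgebra R D :=
  fun z hz => ⟨0, by simpa using hz⟩

theorem awaySubalgebra_mono {R R' : Subalgebra P E} {D : P} (h : R ≤ awaySubalgebra R' D) :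
    awaySubalgebra R D ≤ awaySubalgebra R' D := by
  rintro z ⟨t, ht⟩
  obtain ⟨t', ht'⟩ := h ht
  exact ⟨t' + t, by rwa [pow_add, mul_smul]⟩

variable [Algebra P Ω]

theorem natCard_algHom_awaySubalgebra (R : Subalgebra P E) {D : P} (hDE : algebraMap P E D ≠ 0)
    (hD : algebraMap P Ω D ≠ 0) :
    Nat.card (R →ₐ[P] Ω) = Nat.card (awaySubalgebra R D →ₐ[P] Ω) := by
  set T := awaySubalgebra R D with hT
  let _ : Algebra R T := (Subalgebra.inclusion (le_awaySubalgebra R D)).toRingHom.toAlgebra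
  have hmap : ∀ a : R, ((algebraMap R T a : T) : E) = a := fun a => rfl
  have : IsScalarTower P R T := IsScalarTower.of_algebraMap_eq fun a => rfl
  have hmapP : ∀ a : P, ((algebraMap P T a : T) : E) = algebraMap P E a := fun a => rfl
  have hDinv : (algebraMap P E D)⁻¹ ∈ T := ⟨1, by
    rw [pow_one, Algebra.smul_def, mul_inv_cancel₀ hDE]; exact R.one_mem⟩
  have hloc : IsLocalization (Submonoid.powers (algebraMap P R D)) T := by
    rw [isLocalization_iff]
    refine ⟨?_, ?_, ?_⟩
    · rintro ⟨_, t, rfl⟩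
      simp only [map_pow]
      refine IsUnit.pow _ (IsUnit.of_mul_eq_one ⟨_, hDinv⟩ ?_)
      apply Subtype.ext
      exact mul_inv_cancel₀ hDE
    · rintro ⟨z, t, ht⟩
      refine ⟨(⟨_, ht⟩, ⟨_, t, rfl⟩), ?_⟩
      apply Subtype.ext
      simp only [map_pow]
      change z * (algebraMap P E D) ^ t = D ^ t • z
      rw [Algebra.smul_def, map_pow, mul_comm]
    · intro a b h
      refine ⟨1, ?_⟩
      have : a = b := Subtype.ext (congrArg (fun z : T => (z : E)) h)
      rw [this]
  have hf : ∀ (f : R →ₐ[P] Ω) (y : Submonoid.powers (algebraMap P R D)), IsUnit (f y) := by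
    rintro f ⟨_, t, rfl⟩
    simp only [map_pow, AlgHom.commutes]
    exact (IsUnit.mk0 _ hD).pow t
  refine Nat.card_congr (Equiv.ofBijective
    (fun f => IsLocalization.liftAlgHom (M := Submonoid.powers (algebraMap P R D)) (S := T) (hf f))
    ⟨?_, ?_⟩)
  · intro f g h
    ext a
    have := DFunLike.congr_fun h (algebraMap R T a)
    simpa using this
  · intro f
    refine ⟨f.comp (Algebra.algHom P R T), ?_⟩
    refine IsLocalization.algHom_ext (Submonoid.powers (algebraMap P R D)) ?_
    ext a
    have h : IsLocalization.liftAlgHom (M := Submonoid.powers (algebraMap P R D)) (S := T)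
        (hf (f.comp (Algebra.algHom P R T))) (algebraMap R T a) = f (algebraMap R T a) := by
      simp only [IsLocalization.liftAlgHom_apply, IsLocalization.lift_eq]
      rfl
    exact h

theorem natCard_algHom_eq {R R' : Subalgebra P E} {D : P} (hDE : algebraMap P E D ≠ 0)
    (hD : algebraMap P Ω D ≠ 0) (h : R ≤ awaySubalgebra R' D) (h' : R' ≤ awaySubalgebra R D) :
    Nat.card (R →ₐ[P] Ω) = Nat.card (R' →ₐ[P] Ω) := by
  rw [natCard_algHom_awaySubalgebra R hDE hD, natCard_algHom_awaySubalgebra R' hDE hD,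
    le_antisymm (awaySubalgebra_mono h) (awaySubalgebra_mono h')]

variable {F : Type*} [IsDomain P] [Field F] [Algebra P F] [IsFractionRing P F] [Algebra F E]
  [IsScalarTower P F E]

theorem exists_smul_mem_of_fraction [FiniteDimensional F E] {A : Subalgebra P E}
    (hA : ∀ z : E, ∃ a ∈ A, ∃ b ∈ A, b ≠ 0 ∧ z * b = a) (z : E) :
    ∃ d : P, d ≠ 0 ∧ d • z ∈ A := by
  obtain ⟨a, ha, b, hb, hb0, hz⟩ := hA z
  have hinj : Function.Injective (algebraMap P E) := by
    rw [IsScalarTower.algebraMap_eq P F E]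
    exact (algebraMap F E).injective.comp (IsFractionRing.injective P F)
  have halg : IsAlgebraic P (⟨b, hb⟩ : A) := by
    have h1 : IsAlgebraic F b := Algebra.IsAlgebraic.isAlgebraic b
    have h2 : IsAlgebraic P b := (IsFractionRing.isAlgebraic_iff P F E).mpr h1
    exact (isAlgebraic_algebraMap_iff (A := E) (S := A) Subtype.val_injective).mp h2
  have hb' : (⟨b, hb⟩ : A) ∈ nonZeroDivisors A :=
    mem_nonZeroDivisors_of_ne_zero fun h => hb0 (congrArg Subtype.val h)
  obtain ⟨d, hd, ⟨c, hc⟩, hdc⟩ := halg.exists_nonzero_dvd hb'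
  refine ⟨d, hd, ?_⟩
  have h3 : algebraMap P E d = b * c := congrArg Subtype.val hdc
  rw [Algebra.smul_def, h3, mul_right_comm, mul_comm b z, hz]
  exact A.mul_mem ha hc

theorem exists_smul_mem_adjoin [FiniteDimensional F E] {θ : E}
    (hθ : IntermediateField.adjoin F {θ} = ⊤) (z : E) :
    ∃ d : P, d ≠ 0 ∧ d • z ∈ Algebra.adjoin P {θ} := by
  have hz : z ∈ Algebra.adjoin F {θ} := by
    have h1 := IntermediateField.adjoin_eq_top_iff.mp hθ
    rw [h1]; trivial
  rw [Algebra.adjoin_singleton_eq_range_aeval] at hz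
  obtain ⟨q, rfl⟩ := hz
  obtain ⟨d, hd, hq⟩ := IsLocalization.integerNormalization_spec (nonZeroDivisors P) q
  refine ⟨d, nonZeroDivisors.ne_zero hd, ?_⟩
  rw [Algebra.adjoin_singleton_eq_range_aeval]
  refine ⟨IsLocalization.integerNormalization (nonZeroDivisors P) q, ?_⟩
  change Polynomial.aeval θ _ = d • Polynomial.aeval θ q
  rw [← Polynomial.aeval_map_algebraMap F, hq]
  exact (Polynomial.aeval θ).toLinearMap.map_smul_of_tower d q

theorem exists_integral_primitive [FiniteDimensional F E] [CharZero F] :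
    ∃ θ : E, IsIntegral P θ ∧ IntermediateField.adjoin F {θ} = ⊤ := by
  obtain ⟨θ, hθ⟩ := Field.exists_primitive_element F E
  have hθint : IsIntegral F θ := Algebra.IsIntegral.isIntegral θ
  obtain ⟨⟨d, hd⟩, hintegral⟩ := IsIntegral.exists_multiple_integral_of_isLocalization
    (Rₘ := F)
    (nonZeroDivisors P) θ hθint
  refine ⟨d • θ, hintegral, ?_⟩
  rw [eq_top_iff, ← hθ, IntermediateField.adjoin_simple_le_iff]
  have hdF : algebraMap P F d ≠ 0 := IsLocalization.to_map_ne_zero_of_mem_nonZeroDivisors F le_rfl hd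
  have h1 : (algebraMap P F d)⁻¹ • (d • θ) = θ := by
    rw [← IsScalarTower.algebraMap_smul F d θ, smul_smul, inv_mul_cancel₀ hdF, one_smul]
  have h2 := IntermediateField.smul_mem _ (IntermediateField.mem_adjoin_simple_self F (d • θ))
    (x := (algebraMap P F d)⁻¹)
  rwa [h1] at h2

theorem exists_bezout_of_separable {p : Polynomial P}
    (hp : (p.map (algebraMap P F)).Separable) :
    ∃ d : P, d ≠ 0 ∧ ∃ u w : Polynomial P, u * p + w * Polynomial.derivative p = Polynomial.C d := by
  obtain ⟨u, w, huw⟩ := hp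
  obtain ⟨d, hd, hu⟩ := IsLocalization.integerNormalization_spec (nonZeroDivisors P) u
  obtain ⟨e, he, hw⟩ := IsLocalization.integerNormalization_spec (nonZeroDivisors P) w
  refine ⟨d * e, mul_ne_zero (nonZeroDivisors.ne_zero hd) (nonZeroDivisors.ne_zero he),
    e • IsLocalization.integerNormalization (nonZeroDivisors P) u,
    d • IsLocalization.integerNormalization (nonZeroDivisors P) w, ?_⟩
  apply Polynomial.map_injective _ (IsFractionRing.injective P F)
  simp only [Polynomial.map_add, Polynomial.map_mul, Polynomial.map_smul, hu, hw,
    Polynomial.derivative_map, Polynomial.map_C] at huw ⊢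
  simp only [Algebra.smul_def, Polynomial.algebraMap_apply, map_mul]
  linear_combination (Polynomial.C (algebraMap P F d) * Polynomial.C (algebraMap P F e)) * huw

theorem natCard_algHom_adjoin [IsIntegrallyClosed P] [CharZero P] [IsAlgClosed Ω] {θ : E}
    (hinj : Function.Injective (algebraMap P E)) (hθ : IsIntegral P θ) {d : P}
    {u w : Polynomial P}
    (huw : u * minpoly P θ + w * Polynomial.derivative (minpoly P θ) = Polynomial.C d)
    (hd : algebraMap P Ω d ≠ 0) :
    Nat.card (Algebra.adjoin P {θ} →ₐ[P] Ω) = (minpoly P θ).natDegree := by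
  have : Module.IsTorsionFree P E := Module.isTorsionFree_iff_algebraMap_injective.mpr hinj
  classical
  have hgen : minpoly P (Algebra.adjoin.powerBasis' hθ).gen = minpoly P θ := by
    rw [Algebra.adjoin.powerBasis'_gen, ← minpoly.algebraMap_eq (B' := E) Subtype.val_injective]
    rfl
  set p := (minpoly P θ).map (algebraMap P Ω) with hp
  have hsep : p.Separable := by
    have h1 := congrArg (Polynomial.map (algebraMap P Ω)) huw
    simp only [Polynomial.map_add, Polynomial.map_mul, Polynomial.map_C,
      ← Polynomial.derivative_map, ← hp] at h1
    refine ⟨Polynomial.C (algebraMap P Ω d)⁻¹ * u.map (algebraMap P Ω),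
      Polynomial.C (algebraMap P Ω d)⁻¹ * w.map (algebraMap P Ω), ?_⟩
    rw [mul_assoc, mul_assoc, ← mul_add, h1, ← Polynomial.C_mul, inv_mul_cancel₀ hd,
      Polynomial.C_1]
  rw [Nat.card_congr (Algebra.adjoin.powerBasis' hθ).liftEquiv', hgen]
  rw [← (minpoly.monic hθ).natDegree_map (algebraMap P Ω), ← hp,
    (IsAlgClosed.splits p).natDegree_eq_card_roots,
    ← Multiset.toFinset_card_of_nodup (Polynomial.nodup_roots hsep)]
  rw [← Nat.card_eq_finsetCard]
  refine Nat.card_congr (Equiv.subtypeEquivRight fun y => ?_)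
  rw [Multiset.mem_toFinset, Polynomial.aroots]

/-- The number of points of a generic fibre of a generically finite morphism onto a normal variety
is the degree of the extension of function fields. -/
theorem exists_natCard_algHom_eq_finrank [IsIntegrallyClosed P] [CharZero P] [FiniteDimensional F E]
    {A : Subalgebra P E} (hfg : A.FG)
    (hA : ∀ z : E, ∃ a ∈ A, ∃ b ∈ A, b ≠ 0 ∧ z * b = a) (Ω : Type*) [Field Ω] [IsAlgClosed Ω] :
    ∃ D : P, D ≠ 0 ∧ ∀ _ : Algebra P Ω, algebraMap P Ω D ≠ 0 →
      Nat.card (A →ₐ[P] Ω) = Module.finrank F E := by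
  have hinjF := IsFractionRing.injective P F
  have hinj : Function.Injective (algebraMap P E) := by
    rw [IsScalarTower.algebraMap_eq P F E]
    exact (algebraMap F E).injective.comp hinjF
  have : CharZero F := charZero_of_injective_algebraMap hinjF
  have : Module.IsTorsionFree P E := Module.isTorsionFree_iff_algebraMap_injective.mpr hinj
  obtain ⟨θ, hθ, hθtop⟩ := exists_integral_primitive (P := P) (F := F) (E := E)
  have hmin := minpoly.isIntegrallyClosed_eq_field_fractions' F hθ
  have hdeg : (minpoly P θ).natDegree = Module.finrank F E := by
    rw [← (minpoly.monic hθ).natDegree_map (algebraMap P F), ← hmin]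
    exact (Field.primitive_element_iff_minpoly_natDegree_eq F θ).mp hθtop
  have hsep : ((minpoly P θ).map (algebraMap P F)).Separable := by
    rw [← hmin]
    exact (minpoly.irreducible (Algebra.IsIntegral.isIntegral (R := F) θ)).separable
  obtain ⟨d₀, hd₀, u, w, huw⟩ := exists_bezout_of_separable hsep
  obtain ⟨d₁, hd₁, hθA⟩ := exists_smul_mem_of_fraction (F := F) hA θ
  obtain ⟨S, rfl⟩ := hfg
  choose f hf hfS using exists_smul_mem_adjoin (P := P) hθtop
  refine ⟨d₀ * d₁ * ∏ z ∈ S, f z,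
    mul_ne_zero (mul_ne_zero hd₀ hd₁) (Finset.prod_ne_zero_iff.mpr fun z _ => hf z), ?_⟩
  intro _ hD
  have hDE : algebraMap P E (d₀ * d₁ * ∏ z ∈ S, f z) ≠ 0 := by
    rw [Ne, map_eq_zero_iff _ hinj]
    exact mul_ne_zero (mul_ne_zero hd₀ hd₁) (Finset.prod_ne_zero_iff.mpr fun z _ => hf z)
  rw [natCard_algHom_eq (R' := Algebra.adjoin P {θ}) hDE hD, ← hdeg]
  · refine natCard_algHom_adjoin hinj hθ huw fun h => hD ?_
    simp [h]
  · rw [Algebra.adjoin_le_iff]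
    intro z hz
    refine ⟨1, ?_⟩
    classical
    have h1 : d₀ * d₁ * ∏ z ∈ S, f z = d₀ * d₁ * (∏ z ∈ S.erase z, f z) * f z := by
      rw [← Finset.mul_prod_erase S f hz]; ring
    rw [pow_one, h1, mul_smul]
    exact Subalgebra.smul_mem _ (hfS z) _
  · rw [Algebra.adjoin_le_iff, Set.singleton_subset_iff]
    refine ⟨1, ?_⟩
    rw [pow_one, mul_right_comm, mul_smul]
    exact Subalgebra.smul_mem _ hθA _

end GenericFibre

section Generic

theorem not_algebraicIndependent_option {n : ℕ} {K L : Type*} [Field K] [Field L] [Algebra K L]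
    {x : Fin n → L} {z : Option (Fin n) → L}
    (h : ∀ o, z o ∈ IntermediateField.adjoin K (Set.range x)) : ¬ AlgebraicIndependent K z := by
  intro hz
  have h1 : (AlgebraicIndependent.matroid K L).Indep (Set.range z) := by
    rw [AlgebraicIndependent.matroid_indep_iff]
    exact hz.coe_range
  have h2 : Set.range z ⊆ (AlgebraicIndependent.matroid K L).closure (Set.range x) := by
    rintro _ ⟨o, rfl⟩
    rw [AlgebraicIndependent.matroid_closure_eq, SetLike.mem_coe, Subalgebra.mem_algebraicClosure,
      ← IntermediateField.isAlgebraic_adjoin_iff]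
    exact isAlgebraic_algebraMap (⟨z o, h o⟩ : IntermediateField.adjoin K (Set.range x))
  have h3 := h1.encard_le_eRk_of_subset h2
  rw [Matroid.eRk_closure_eq] at h3
  have h4 := h3.trans (Matroid.eRk_le_encard _ _)
  rw [← Set.image_univ, ← Set.image_univ, hz.injective.encard_image] at h4
  have h5 := h4.trans (Set.encard_image_le _ _)
  simp only [Set.encard_univ, ENat.card_eq_coe_fintype_card, Fintype.card_option, Fintype.card_fin,
    Nat.cast_le] at h5
  omega

theorem linearIndependent_mon {n : ℕ} {k L : Type*} [Field k] [Field L] [Algebra k L]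
    {x : Fin n → Lˣ} (hx : AlgebraicIndependent k (fun l => (x l : L))) :
    LinearIndependent k (fun r : Fin n → ℤ => ((mon x r : Lˣ) : L)) := by
  have h1 : LinearIndependent k (fun e : Fin n →₀ ℕ =>
      MvPolynomial.aeval (fun l => (x l : L)) (MvPolynomial.monomial e (1 : k))) := by
    have h2 := (MvPolynomial.basisMonomials (Fin n) k).linearIndependent
    rw [MvPolynomial.coe_basisMonomials] at h2
    exact h2.map' (MvPolynomial.aeval (fun l => (x l : L))).toLinearMap
      (LinearMap.ker_eq_bot.mpr hx)
  rw [linearIndependent_iff_finset_linearIndependent]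
  intro S
  let N : Fin n → ℤ := fun l => ∑ r ∈ S, |r l|
  have hN : ∀ r ∈ S, ∀ l, 0 ≤ N l + r l := by
    intro r hr l
    have h2 : |r l| ≤ N l := Finset.single_le_sum (f := fun r : Fin n → ℤ => |r l|)
      (fun _ _ => abs_nonneg _) hr
    linarith [neg_abs_le (r l)]
  let e : S → (Fin n →₀ ℕ) := fun r => Finsupp.equivFunOnFinite.symm fun l => (N l + r.1 l).toNat
  have he : Function.Injective e := by
    intro r r' h
    apply Subtype.ext
    funext l
    have h2 : (N l + r.1 l).toNat = (N l + r'.1 l).toNat := DFunLike.congr_fun h l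
    have h3 := hN r.1 r.2 l
    have h4 := hN r'.1 r'.2 l
    omega
  refine LinearIndependent.of_comp (LinearMap.mulLeft k ((mon x N : Lˣ) : L)) ?_
  convert h1.comp e he using 1
  swap
  · rfl
  funext r
  simp only [Function.comp_apply, LinearMap.mulLeft_apply, ← Units.val_mul, ← mon_add,
    MvPolynomial.aeval_monomial, map_one, one_mul]
  rw [Finsupp.prod_fintype _ _ (fun _ => pow_zero _), mon, Units.coe_prod]
  refine Finset.prod_congr rfl fun l _ => ?_
  have h2 := Int.toNat_of_nonneg (hN r.1 r.2 l)
  have h3 : x l ^ (N + r.1) l = x l ^ (N l + r.1 l).toNat := by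
    rw [← zpow_natCast, h2]; rfl
  rw [h3, Units.val_pow_eq_pow_val]
  rfl

variable {κ L : Type*} [Field κ] [Field L] [Algebra κ L] {n s : ℕ} {x : Fin n → Lˣ}
  {a : Fin n × Fin s → L}

theorem algebraicIndependent_adjoin_right
    (hw : AlgebraicIndependent κ (Sum.elim (fun l => (x l : L)) a)) :
    AlgebraicIndependent (IntermediateField.adjoin κ (Set.range a)) (fun l => (x l : L)) :=
  IntermediateField.algebraicIndependent_adjoin_iff.mpr (AlgebraicIndependent.sumElim_iff.mp hw).2

/-- The right-hand sides of the generic system with coefficients `a` and monomials `v`. -/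
def genericSum (x : Fin n → Lˣ) (a : Fin n × Fin s → L) (v : Fin s → Fin n → ℤ) (i : Fin n) : L :=
  ∑ j, a (i, j) * ((mon x (v j) : Lˣ) : L)

theorem mon_mem {k L : Type*} [Field k] [Field L] [Algebra k L] {x : Fin n → Lˣ}
    (K : IntermediateField k L) (hK : ∀ l, (x l : L) ∈ K) (r : Fin n → ℤ) :
    ((mon x r : Lˣ) : L) ∈ K := by
  rw [mon, Units.coe_prod]
  refine K.prod_mem fun l _ => ?_
  rw [Units.val_zpow_eq_zpow_val]
  exact zpow_mem (hK l) _

theorem filtered_integral_genericSum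
    (hw : AlgebraicIndependent κ (Sum.elim (fun l => (x l : L)) a)) (v : Fin s → Fin n → ℤ)
    (j : Fin s) :
    ∃ d, ((mon x (v j) : Lˣ) : L) ^ (d + 1) ∈
      degreeOne (IntermediateField.adjoin κ (Set.range a)) (genericSum x a v) *
        (degreeOne (IntermediateField.adjoin κ (Set.range a)) (genericSum x a v) ⊔
          Submodule.span (IntermediateField.adjoin κ (Set.range a))
            {((mon x (v j) : Lˣ) : L)}) ^ d := by
  classical
  have ha : AlgebraicIndependent κ a := (AlgebraicIndependent.sumElim_iff.mp hw).1
  let k := IntermediateField.adjoin κ (Set.range a)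
  let K := IntermediateField.adjoin κ (a '' {p | p.2 ≠ j})
  have hKk : K ≤ k := IntermediateField.adjoin.mono _ _ _ (Set.image_subset_range _ _)
  let _ : Algebra K k := (IntermediateField.inclusion hKk).toRingHom.toAlgebra
  have : IsScalarTower K k L := IsScalarTower.of_algebraMap_eq fun _ => rfl
  have hak : ∀ p, a p ∈ k := fun p => IntermediateField.subset_adjoin _ _ ⟨p, rfl⟩
  let u : Fin n → k := fun i => ⟨a (i, j), hak _⟩
  have hu : AlgebraicIndependent K u := by
    have h1 := ((AlgebraicIndependent.iff_adjoin_image {p : Fin n × Fin s | p.2 ≠ j}).mp ha).2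
    have h2 := IntermediateField.algebraicIndependent_adjoin_iff.mpr h1
    have h3 : AlgebraicIndependent K (fun i : Fin n => a (i, j)) :=
      h2.comp (fun i => ⟨(i, j), by simp⟩) fun i i' h => by simpa using h
    exact AlgebraicIndependent.of_comp (IsScalarTower.toAlgHom K k L) h3
  refine exists_filtered_integral (K := K) hu
    (g' := fun i => ∑ j' ∈ Finset.univ.erase j, a (i, j') * ((mon x (v j') : Lˣ) : L))
    (not_algebraicIndependent_option (x := fun l => (x l : L)) ?_) ?_
  · have hxm : ∀ r : Fin n → ℤ, ((mon x r : Lˣ) : L) ∈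
        IntermediateField.adjoin K (Set.range fun l => (x l : L)) :=
      mon_mem _ fun l => IntermediateField.subset_adjoin _ _ ⟨l, rfl⟩
    rintro (_ | i)
    · exact hxm _
    · refine sum_mem fun j' hj' => mul_mem ?_ (hxm _)
      exact IntermediateField.algebraMap_mem _ (⟨a (i, j'), IntermediateField.subset_adjoin _ _
        ⟨(i, j'), Finset.ne_of_mem_erase hj', rfl⟩⟩ : K)
  · intro i
    rw [genericSum, ← Finset.sum_erase_add _ _ (Finset.mem_univ j)]
    rfl

end Generic

section Specialization

theorem exists_subring_ringHom_extension {R L Ω : Type*} [CommRing R] [Field L] [Field Ω]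
    {f : R →+* L} (hf : Function.Injective f) (ev : R →+* Ω) :
    ∃ (B : Subring L) (φ : B →+* Ω), (∀ r, ∃ h : f r ∈ B, φ ⟨f r, h⟩ = ev r) ∧
      ∀ r, ev r ≠ 0 → (f r)⁻¹ ∈ B := by
  have : (RingHom.ker ev).IsPrime := RingHom.ker_isPrime ev
  let M := (RingHom.ker ev).primeCompl
  have hM : ∀ r : M, ev r ≠ 0 := fun r h => r.2 h
  have hM' : ∀ r : M, f r ≠ 0 := fun r h => hM r <| by
    rw [(map_eq_zero_iff f hf).mp h, map_zero]
  have hu : ∀ r : M, IsUnit (f r) := fun r => IsUnit.mk0 _ (hM' r)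
  let α : Localization M →+* L := IsLocalization.lift hu
  let β : Localization M →+* Ω := IsLocalization.lift fun r : M => IsUnit.mk0 _ (hM r)
  have hα : Function.Injective α := by
    rw [IsLocalization.lift_injective_iff]
    intro r r'
    rw [hf.eq_iff]
    refine ⟨fun h => ?_, fun h => by rw [h]⟩
    obtain ⟨m, hm⟩ := (IsLocalization.eq_iff_exists M (Localization M)).mp h
    have h1 := congrArg f hm
    rw [map_mul, map_mul] at h1
    exact hf (mul_left_cancel₀ (hM' m) h1)
  let e : Localization M ≃+* α.range := RingEquiv.ofBijective α.rangeRestrict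
    ⟨fun z z' h => hα (congrArg Subtype.val h), α.rangeRestrict_surjective⟩
  refine ⟨α.range, β.comp e.symm.toRingHom, fun r => ?_, fun r hr => ?_⟩
  · have h1 : α (algebraMap R _ r) = f r := IsLocalization.lift_eq _ _
    refine ⟨⟨_, h1⟩, ?_⟩
    have h2 : e.symm ⟨f r, _, h1⟩ = algebraMap R _ r := by
      rw [RingEquiv.symm_apply_eq]
      exact Subtype.ext h1.symm
    change β (e.symm _) = _
    rw [h2]
    exact IsLocalization.lift_eq _ _
  · refine ⟨IsLocalization.mk' _ 1 (⟨r, hr⟩ : M), ?_⟩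
    refine eq_inv_of_mul_eq_one_left ?_
    have h1 : α (algebraMap R _ r) = f r := IsLocalization.lift_eq _ _
    have h2 := IsLocalization.mk'_spec (Localization M) 1 (⟨r, hr⟩ : M)
    rw [← h1, ← map_mul]
    exact (congrArg α h2).trans (by rw [map_one, map_one])

variable {κ L : Type*} [Field κ] [Field L] [Algebra κ L] {n s : ℕ} {x : Fin n → Lˣ}
  {a : Fin n × Fin s → L}

theorem exists_algHom_of_solution
    (hw : AlgebraicIndependent κ (Sum.elim (fun l => (x l : L)) a)) {v : Fin s → Fin n → ℤ}
    [Algebra (MvPolynomial (Fin n ⊕ Fin n × Fin s) κ) L]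
    [Algebra (MvPolynomial (Fin n ⊕ Fin n × Fin s) κ) κ]
    (hL : ∀ p : MvPolynomial (Fin n ⊕ Fin n × Fin s) κ,
      algebraMap _ L p = MvPolynomial.aeval (Sum.elim (genericSum x a v) a) p)
    {c : Fin n ⊕ Fin n × Fin s → κ}
    (hc : ∀ p : MvPolynomial (Fin n ⊕ Fin n × Fin s) κ, algebraMap _ κ p = MvPolynomial.eval c p)
    {lam : Fin n → κˣ}
    (hlam : ∀ i, c (.inl i) = ∑ j, c (.inr (i, j)) * ((mon lam (v j) : κˣ) : κ)) :
    ∃ (B : Subalgebra (MvPolynomial (Fin n ⊕ Fin n × Fin s) κ) L)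
      (φ : B →ₐ[MvPolynomial (Fin n ⊕ Fin n × Fin s) κ] κ),
      ∀ l, ((x l)⁻¹ : L) ∈ B ∧ ∃ h : (x l : L) ∈ B, φ ⟨x l, h⟩ = lam l := by
  let f : MvPolynomial (Fin n ⊕ Fin n × Fin s) κ →+* L :=
    (MvPolynomial.aeval (Sum.elim (fun l => (x l : L)) a)).toRingHom
  let ev : MvPolynomial (Fin n ⊕ Fin n × Fin s) κ →+* κ :=
    MvPolynomial.eval (Sum.elim (fun l => (lam l : κ)) fun p => c (.inr p))
  obtain ⟨B, φ, hB, hinv⟩ := exists_subring_ringHom_extension (f := f) hw ev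
  let rb : MvPolynomial (Fin n ⊕ Fin n × Fin s) κ →+* B := f.codRestrict B fun r => (hB r).1
  have hrb : ∀ r, φ (rb r) = ev r := fun r => (hB r).2
  have hfx : ∀ l, f (.X (.inl l)) = x l := fun l => MvPolynomial.aeval_X _ _
  have hfa : ∀ p, f (.X (.inr p)) = a p := fun l => MvPolynomial.aeval_X _ _
  have hevx : ∀ l, ev (.X (.inl l)) = lam l := fun l => MvPolynomial.eval_X _
  have heva : ∀ p, ev (.X (.inr p)) = c (.inr p) := fun p => MvPolynomial.eval_X _
  have hxinv : ∀ l, ((x l)⁻¹ : L) ∈ B := by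
    intro l
    rw [← hfx l]
    exact hinv _ (by rw [hevx]; exact (lam l).ne_zero)
  let ζ : Fin n → Bˣ := fun l => ⟨rb (.X (.inl l)), ⟨_, hxinv l⟩,
    Subtype.ext (by change f _ * _ = 1; rw [hfx, mul_inv_cancel₀ (x l).ne_zero]),
    Subtype.ext (by change _ * f _ = 1; rw [hfx, inv_mul_cancel₀ (x l).ne_zero])⟩
  have hζ : ∀ r, (((mon ζ r : Bˣ) : B) : L) = ((mon x r : Lˣ) : L) := by
    intro r
    have h1 := map_mon ζ (Units.map (B.subtype : B →* L)) r
    have h2 : (fun l => Units.map (B.subtype : B →* L) (ζ l)) = x :=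
      funext fun l => Units.ext (hfx l)
    rw [h2] at h1
    exact congrArg Units.val h1
  have hζφ : ∀ r, φ ((mon ζ r : Bˣ) : B) = ((mon lam r : κˣ) : κ) := by
    intro r
    have h1 := map_mon ζ (Units.map (φ : B →* κ)) r
    have h2 : (fun l => Units.map (φ : B →* κ) (ζ l)) = lam :=
      funext fun l => Units.ext ((hrb _).trans (hevx l))
    rw [h2] at h1
    exact congrArg Units.val h1
  let γ : MvPolynomial (Fin n ⊕ Fin n × Fin s) κ →+* B :=
    MvPolynomial.eval₂Hom (rb.comp MvPolynomial.C)
      (Sum.elim (fun i => ∑ j, rb (.X (.inr (i, j))) * ((mon ζ (v j) : Bˣ) : B))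
        fun p => rb (.X (.inr p)))
  have hγL : B.subtype.comp γ = algebraMap (MvPolynomial (Fin n ⊕ Fin n × Fin s) κ) L := by
    refine MvPolynomial.ringHom_ext (fun r => ?_) ?_
    · rw [hL, MvPolynomial.aeval_C, RingHom.comp_apply, MvPolynomial.eval₂Hom_C]
      exact MvPolynomial.aeval_C _ _
    · rintro (i | p)
      · rw [hL, MvPolynomial.aeval_X, RingHom.comp_apply, MvPolynomial.eval₂Hom_X', Sum.elim_inl,
          Sum.elim_inl, map_sum, genericSum]
        refine Finset.sum_congr rfl fun j _ => ?_
        rw [map_mul, ← hζ, ← hfa]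
        rfl
      · rw [hL, MvPolynomial.aeval_X, RingHom.comp_apply, MvPolynomial.eval₂Hom_X']
        exact hfa p
  have hγκ : φ.comp γ = algebraMap (MvPolynomial (Fin n ⊕ Fin n × Fin s) κ) κ := by
    refine MvPolynomial.ringHom_ext (fun r => ?_) ?_
    · rw [hc, MvPolynomial.eval_C, RingHom.comp_apply, MvPolynomial.eval₂Hom_C,
        RingHom.comp_apply, hrb]
      exact MvPolynomial.eval_C _
    · rintro (i | p)
      · rw [hc, MvPolynomial.eval_X, RingHom.comp_apply, MvPolynomial.eval₂Hom_X', Sum.elim_inl,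
          map_sum, hlam]
        refine Finset.sum_congr rfl fun j _ => ?_
        rw [map_mul, hζφ, hrb, heva]
      · rw [hc, MvPolynomial.eval_X, RingHom.comp_apply, MvPolynomial.eval₂Hom_X', Sum.elim_inr,
          hrb, heva]
  let B' : Subalgebra (MvPolynomial (Fin n ⊕ Fin n × Fin s) κ) L :=
    { B with
      algebraMap_mem' := fun p => by
        rw [← hγL]
        exact (γ p).2 }
  let φ' : B' →ₐ[MvPolynomial (Fin n ⊕ Fin n × Fin s) κ] κ :=
    { (φ : B →+* κ) with
      commutes' := fun p => by
        rw [← hγκ]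
        change φ _ = φ _
        congr 1
        apply Subtype.ext
        change algebraMap _ L p = _
        rw [← hγL]
        rfl }
  refine ⟨B', φ', fun l => ⟨hxinv l, ?_⟩⟩
  have h1 : (x l : L) ∈ B := by rw [← hfx]; exact (hB _).1
  refine ⟨h1, ?_⟩
  rw [← hevx l, ← hrb]
  change φ _ = φ _
  congr 1
  exact Subtype.ext (hfx l).symm

theorem natCard_algHom_eq_natCard_solutions
    (hw : AlgebraicIndependent κ (Sum.elim (fun l => (x l : L)) a)) {v : Fin s → Fin n → ℤ}
    [Algebra (MvPolynomial (Fin n ⊕ Fin n × Fin s) κ) L]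
    [Algebra (MvPolynomial (Fin n ⊕ Fin n × Fin s) κ) κ]
    (hL : ∀ p : MvPolynomial (Fin n ⊕ Fin n × Fin s) κ,
      algebraMap _ L p = MvPolynomial.aeval (Sum.elim (genericSum x a v) a) p)
    {c : Fin n ⊕ Fin n × Fin s → κ}
    (hc : ∀ p : MvPolynomial (Fin n ⊕ Fin n × Fin s) κ, algebraMap _ κ p = MvPolynomial.eval c p) :
    Nat.card (Algebra.adjoin (MvPolynomial (Fin n ⊕ Fin n × Fin s) κ)
        (Set.range (fun l => (x l : L)) ∪ Set.range fun l => ((x l)⁻¹ : L)) →ₐ[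
          MvPolynomial (Fin n ⊕ Fin n × Fin s) κ] κ) =
      Nat.card {lam : Fin n → κˣ |
        ∀ i, c (.inl i) = ∑ j, c (.inr (i, j)) * ((mon lam (v j) : κˣ) : κ)} := by
  set A := Algebra.adjoin (MvPolynomial (Fin n ⊕ Fin n × Fin s) κ)
    (Set.range (fun l => (x l : L)) ∪ Set.range fun l => ((x l)⁻¹ : L)) with hA
  have hxA : ∀ l, (x l : L) ∈ A := fun l => Algebra.subset_adjoin (.inl ⟨l, rfl⟩)
  have hxA' : ∀ l, ((x l)⁻¹ : L) ∈ A := fun l => Algebra.subset_adjoin (.inr ⟨l, rfl⟩)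
  let ξ : Fin n → Aˣ := fun l => ⟨⟨x l, hxA l⟩, ⟨_, hxA' l⟩,
    Subtype.ext (mul_inv_cancel₀ (x l).ne_zero), Subtype.ext (inv_mul_cancel₀ (x l).ne_zero)⟩
  have hξ : ∀ r, (((mon ξ r : Aˣ) : A) : L) = ((mon x r : Lˣ) : L) := by
    intro r
    have h1 := map_mon ξ (Units.map (A.val : A →* L)) r
    have h2 : (fun l => Units.map (A.val : A →* L) (ξ l)) = x := funext fun l => Units.ext rfl
    rw [h2] at h1
    exact congrArg Units.val h1
  have hsys : ∀ i, algebraMap (MvPolynomial (Fin n ⊕ Fin n × Fin s) κ) A (.X (.inl i)) =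
      ∑ j, algebraMap (MvPolynomial (Fin n ⊕ Fin n × Fin s) κ) A (.X (.inr (i, j))) * ((mon ξ (v j) : Aˣ) : A) := by
    intro i
    have hval : Function.Injective A.val := Subtype.val_injective
    apply hval
    rw [map_sum]
    simp only [map_mul, AlgHom.commutes]
    rw [hL, MvPolynomial.aeval_X, Sum.elim_inl, genericSum]
    refine Finset.sum_congr rfl fun j _ => ?_
    rw [hL, MvPolynomial.aeval_X, Sum.elim_inr, ← hξ]
    rfl
  refine Nat.card_congr (Equiv.ofBijective (fun φ => ⟨fun l => Units.map (φ : A →* κ) (ξ l), ?_⟩)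
    ⟨?_, ?_⟩)
  · intro i
    have h1 := congrArg φ (hsys i)
    rw [map_sum] at h1
    simp only [map_mul, AlgHom.commutes, hc, MvPolynomial.eval_X] at h1
    rw [h1]
    refine Finset.sum_congr rfl fun j _ => ?_
    rw [← map_mon]
    rfl
  · intro φ ψ h
    have h1 : ∀ l, Units.map (φ : A →* κ) (ξ l) = Units.map (ψ : A →* κ) (ξ l) := fun l =>
      congrFun (congrArg Subtype.val h) l
    refine AlgHom.adjoin_ext fun z hz => ?_
    obtain ⟨l, rfl⟩ | ⟨l, rfl⟩ := hz
    · exact congrArg Units.val (h1 l)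
    · have h2 := congrArg (fun u => ((u⁻¹ : κˣ) : κ)) (h1 l)
      simp only [← map_inv] at h2
      exact h2
  · rintro ⟨lam, hlam⟩
    obtain ⟨B, φ, hφ⟩ := exists_algHom_of_solution hw hL hc hlam
    have hAB : A ≤ B := by
      rw [hA, Algebra.adjoin_le_iff]
      rintro _ (⟨l, rfl⟩ | ⟨l, rfl⟩)
      · exact (hφ l).2.1
      · exact (hφ l).1
    refine ⟨φ.comp (Subalgebra.inclusion hAB), Subtype.ext (funext fun l => Units.ext ?_)⟩
    exact (hφ l).2.2

end Specialization

section FunctionField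

variable {κ L : Type*} [Field κ] [Field L] [Algebra κ L] {n s : ℕ} {x : Fin n → Lˣ}
  {a : Fin n × Fin s → L} {v : Fin s → Fin n → ℤ}

theorem adjoin_monomials_eq_top
    (htop : IntermediateField.adjoin κ (Set.range (Sum.elim (fun l => (x l : L)) a)) = ⊤) :
    IntermediateField.adjoin (IntermediateField.adjoin κ (Set.range a))
      (Set.range fun l => (x l : L)) = ⊤ := by
  apply IntermediateField.restrictScalars_injective κ
  rw [IntermediateField.adjoin_adjoin_left, IntermediateField.restrictScalars_top, ← htop,
    Set.Sum.elim_range, Set.union_comm]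

theorem finiteDimensional_genericSum
    (hw : AlgebraicIndependent κ (Sum.elim (fun l => (x l : L)) a))
    (htop : IntermediateField.adjoin κ (Set.range (Sum.elim (fun l => (x l : L)) a)) = ⊤)
    (hv : Submodule.span ℝ (Set.range fun j (l : Fin n) => (v j l : ℝ)) = ⊤) :
    FiniteDimensional (IntermediateField.adjoin (IntermediateField.adjoin κ (Set.range a))
      (Set.range (genericSum x a v))) L :=
  finiteDimensional_of_filtered_integral (k := IntermediateField.adjoin κ (Set.range a))
    (g := fun i => ⟨genericSum x a v i, IntermediateField.subset_adjoin _ _ ⟨i, rfl⟩⟩)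
    hv (adjoin_monomials_eq_top htop) (filtered_integral_genericSum hw v)

theorem algebraicIndependent_genericSum
    (hw : AlgebraicIndependent κ (Sum.elim (fun l => (x l : L)) a))
    (htop : IntermediateField.adjoin κ (Set.range (Sum.elim (fun l => (x l : L)) a)) = ⊤)
    (hv : Submodule.span ℝ (Set.range fun j (l : Fin n) => (v j l : ℝ)) = ⊤) :
    AlgebraicIndependent (IntermediateField.adjoin κ (Set.range a)) (genericSum x a v) := by
  have := finiteDimensional_genericSum hw htop hv
  have h1 : Algebra.IsAlgebraic (Algebra.adjoin (IntermediateField.adjoin κ (Set.range a))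
      (Set.range (genericSum x a v))) L :=
    IntermediateField.isAlgebraic_adjoin_iff_top.mp inferInstance
  exact (Algebra.IsAlgebraic.isTranscendenceBasis_of_lift_le_trdeg_of_finite _ _
    (algebraicIndependent_adjoin_right hw).lift_cardinalMk_le_trdeg).1

theorem algebraicIndependent_sumElim_genericSum
    (hw : AlgebraicIndependent κ (Sum.elim (fun l => (x l : L)) a))
    (htop : IntermediateField.adjoin κ (Set.range (Sum.elim (fun l => (x l : L)) a)) = ⊤)
    (hv : Submodule.span ℝ (Set.range fun j (l : Fin n) => (v j l : ℝ)) = ⊤) :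
    AlgebraicIndependent κ (Sum.elim (genericSum x a v) a) := by
  refine AlgebraicIndependent.sumElim_of_tower (S := IntermediateField.adjoin κ (Set.range a))
    (AlgebraicIndependent.sumElim_iff.mp hw).1 ?_ (algebraicIndependent_genericSum hw htop hv)
  rintro _ ⟨p, rfl⟩
  exact ⟨⟨a p, IntermediateField.subset_adjoin _ _ ⟨p, rfl⟩⟩, rfl⟩

theorem finrank_genericSum
    (hw : AlgebraicIndependent κ (Sum.elim (fun l => (x l : L)) a))
    (htop : IntermediateField.adjoin κ (Set.range (Sum.elim (fun l => (x l : L)) a)) = ⊤)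
    (hv : Submodule.span ℝ (Set.range fun j (l : Fin n) => (v j l : ℝ)) = ⊤) :
    (Module.finrank (IntermediateField.adjoin (IntermediateField.adjoin κ (Set.range a))
      (Set.range (genericSum x a v))) L : ℝ) = n.factorial * MeasureTheory.volume.real
        (convexHull ℝ (insert 0 (Set.range fun j (l : Fin n) => (v j l : ℝ)))) := by
  have := finiteDimensional_genericSum hw htop hv
  let k := IntermediateField.adjoin κ (Set.range a)
  let F := IntermediateField.adjoin k (Set.range (genericSum x a v))
  let g : Fin n → F := fun i =>
    ⟨genericSum x a v i, IntermediateField.subset_adjoin _ _ ⟨i, rfl⟩⟩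
  have hgv : F.val ∘ g = genericSum x a v := rfl
  have hx := linearIndependent_mon (algebraicIndependent_adjoin_right hw)
  have hg : AlgebraicIndependent k g :=
    AlgebraicIndependent.of_comp F.val (algebraicIndependent_genericSum hw htop hv)
  have hadj : ∀ z ∈ Algebra.adjoin k (Set.range (genericSum x a v)),
      ∃ p ∈ Algebra.adjoin k (Set.range g), F.val p = z := by
    intro z hz
    rwa [← hgv, Set.range_comp, ← AlgHom.map_adjoin] at hz
  refine eq_factorial_mul_volume
    (ncard_latticePts_le (g := g) hx (fun z => ?_) (filtered_integral_genericSum hw v))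
    (le_ncard_latticePts hv hx (adjoin_monomials_eq_top htop) hg fun i => ?_)
  · obtain ⟨p, hp, q, hq, hpq⟩ := IntermediateField.mem_adjoin_iff_div.mp z.2
    obtain ⟨p', hp', rfl⟩ := hadj p hp
    obtain ⟨q', hq', rfl⟩ := hadj q hq
    have hz : z = p' / q' := Subtype.ext hpq
    by_cases hq0 : q' = 0
    · exact ⟨0, zero_mem _, 1, one_mem _, one_ne_zero, by rw [hz, hq0, div_zero, zero_mul]⟩
    · exact ⟨p', hp', q', hq', hq0, by rw [hz, div_mul_cancel₀ _ hq0]⟩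
  · change ∑ j, a (i, j) * ((mon x (v j) : Lˣ) : L) ∈ _
    refine Submodule.sum_mem _ fun j _ => ?_
    exact Submodule.smul_mem _ (⟨a (i, j), IntermediateField.subset_adjoin _ _ ⟨_, rfl⟩⟩ : k)
      (Submodule.subset_span ⟨j, rfl⟩)

theorem exists_natCard_solutions_eq_finrank [IsAlgClosed κ] [CharZero κ]
    (hw : AlgebraicIndependent κ (Sum.elim (fun l => (x l : L)) a))
    (htop : IntermediateField.adjoin κ (Set.range (Sum.elim (fun l => (x l : L)) a)) = ⊤)
    (hv : Submodule.span ℝ (Set.range fun j (l : Fin n) => (v j l : ℝ)) = ⊤) :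
    ∃ D : MvPolynomial (Fin n ⊕ Fin n × Fin s) κ, D ≠ 0 ∧ ∀ c, MvPolynomial.eval c D ≠ 0 →
      Nat.card {lam : Fin n → κˣ |
        ∀ i, c (.inl i) = ∑ j, c (.inr (i, j)) * ((mon lam (v j) : κˣ) : κ)} =
      Module.finrank (IntermediateField.adjoin (IntermediateField.adjoin κ (Set.range a))
        (Set.range (genericSum x a v))) L := by
  classical
  have := finiteDimensional_genericSum hw htop hv
  let k := IntermediateField.adjoin κ (Set.range a)
  let F := IntermediateField.adjoin k (Set.range (genericSum x a v))
  have hind := algebraicIndependent_sumElim_genericSum hw htop hv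
  let b : Fin n ⊕ Fin n × Fin s → F := Sum.elim
    (fun i => ⟨genericSum x a v i, IntermediateField.subset_adjoin _ _ ⟨i, rfl⟩⟩)
    fun p => algebraMap k F ⟨a p, IntermediateField.subset_adjoin _ _ ⟨p, rfl⟩⟩
  have hb : ∀ q, algebraMap F L (b q) = Sum.elim (genericSum x a v) a q := by
    rintro (i | p) <;> rfl
  let _ : Algebra (MvPolynomial (Fin n ⊕ Fin n × Fin s) κ) L :=
    (MvPolynomial.aeval (Sum.elim (genericSum x a v) a)).toRingHom.toAlgebra
  let _ : Algebra (MvPolynomial (Fin n ⊕ Fin n × Fin s) κ) F :=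
    (MvPolynomial.aeval b).toRingHom.toAlgebra
  have hL : ∀ p : MvPolynomial (Fin n ⊕ Fin n × Fin s) κ,
    algebraMap _ L p = MvPolynomial.aeval (Sum.elim (genericSum x a v) a) p := fun p => rfl
  have : IsScalarTower (MvPolynomial (Fin n ⊕ Fin n × Fin s) κ) F L := by
    refine IsScalarTower.of_algebraMap_eq' (MvPolynomial.ringHom_ext (fun r => ?_) fun q => ?_)
    · exact (MvPolynomial.aeval_C _ _).trans
        (congrArg (algebraMap F L) (MvPolynomial.aeval_C b r)).symm
    · exact (MvPolynomial.aeval_X _ _).trans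
        ((congrArg (algebraMap F L) (MvPolynomial.aeval_X b q)).trans (hb q)).symm
  have : IsFractionRing (MvPolynomial (Fin n ⊕ Fin n × Fin s) κ) F := by
    have : FaithfulSMul (MvPolynomial (Fin n ⊕ Fin n × Fin s) κ) F := by
      rw [faithfulSMul_iff_algebraMap_injective]
      refine Function.Injective.of_comp (f := algebraMap F L) ?_
      rw [← RingHom.coe_comp, ← IsScalarTower.algebraMap_eq]
      exact hind
    refine IsFractionRing.of_field _ _ fun z => ?_
    have hz : (z : L) ∈ IntermediateField.adjoin κ
        (Set.range (Sum.elim (genericSum x a v) a)) := by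
      rw [Set.Sum.elim_range, Set.union_comm, ← IntermediateField.adjoin_adjoin_left]
      exact z.2
    obtain ⟨p, q, hpq⟩ := (IntermediateField.mem_adjoin_range_iff _ _ _).mp hz
    refine ⟨p, q, (algebraMap F L).injective ?_⟩
    rw [map_div₀, ← IsScalarTower.algebraMap_apply, ← IsScalarTower.algebraMap_apply]
    exact hpq
  let A := Algebra.adjoin (MvPolynomial (Fin n ⊕ Fin n × Fin s) κ)
    (Set.range (fun l => (x l : L)) ∪ Set.range fun l => ((x l)⁻¹ : L))
  have hfg : A.FG := by
    refine ⟨((Set.finite_range fun l => (x l : L)).union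
      (Set.finite_range fun l => ((x l)⁻¹ : L))).toFinset, ?_⟩
    rw [Set.Finite.coe_toFinset]
  have hA : ∀ z : L, ∃ p ∈ A, ∃ q ∈ A, q ≠ 0 ∧ z * q = p := by
    have hmem : ∀ r : MvPolynomial (Fin n ⊕ Fin n × Fin s) κ,
        MvPolynomial.aeval (Sum.elim (fun l => (x l : L)) a) r ∈ A := by
      intro r
      induction r using MvPolynomial.induction_on with
      | C r =>
        rw [MvPolynomial.aeval_C, ← MvPolynomial.aeval_C (Sum.elim (genericSum x a v) a), ← hL]
        exact A.algebraMap_mem _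
      | add p q hp hq => rw [map_add]; exact A.add_mem hp hq
      | mul_X p q hp =>
        rw [map_mul, MvPolynomial.aeval_X]
        refine A.mul_mem hp ?_
        rcases q with l | q
        · exact Algebra.subset_adjoin (.inl ⟨l, rfl⟩)
        · have h1 := A.algebraMap_mem (.X (.inr q))
          rwa [hL, MvPolynomial.aeval_X] at h1
    intro z
    have hz : z ∈ IntermediateField.adjoin κ (Set.range (Sum.elim (fun l => (x l : L)) a)) := by
      rw [htop]; trivial
    obtain ⟨p, q, hpq⟩ := (IntermediateField.mem_adjoin_range_iff _ _ _).mp hz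
    by_cases hq : MvPolynomial.aeval (Sum.elim (fun l => (x l : L)) a) q = 0
    · exact ⟨0, A.zero_mem, 1, A.one_mem, one_ne_zero, by rw [hpq, hq, div_zero, zero_mul]⟩
    · exact ⟨_, hmem p, _, hmem q, hq, by rw [hpq, div_mul_cancel₀ _ hq]⟩
  obtain ⟨D, hD, h⟩ := exists_natCard_algHom_eq_finrank (F := F) hfg hA κ
  refine ⟨D, hD, fun c hc => ?_⟩
  let _ : Algebra (MvPolynomial (Fin n ⊕ Fin n × Fin s) κ) κ := (MvPolynomial.eval c).toAlgebra
  rw [← natCard_algHom_eq_natCard_solutions hw hL fun _ => rfl]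
  exact h _ hc

end FunctionField

theorem algebraicIndependent_fractionRing_X (σ κ : Type*) [Field κ] :
    AlgebraicIndependent κ fun q : σ => algebraMap (MvPolynomial σ κ)
      (FractionRing (MvPolynomial σ κ)) (MvPolynomial.X q) :=
  (MvPolynomial.algebraicIndependent_X σ κ).map'
    (f := IsScalarTower.toAlgHom κ (MvPolynomial σ κ) (FractionRing (MvPolynomial σ κ)))
    (IsFractionRing.injective _ _)

theorem adjoin_fractionRing_X (σ κ : Type*) [Field κ] :
    IntermediateField.adjoin κ (Set.range fun q : σ => algebraMap (MvPolynomial σ κ)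
      (FractionRing (MvPolynomial σ κ)) (MvPolynomial.X q)) = ⊤ := by
  refine eq_top_iff.mpr fun z _ => ?_
  obtain ⟨p, q, -, rfl⟩ := IsFractionRing.div_surjective (A := MvPolynomial σ κ) z
  have h : ∀ r : MvPolynomial σ κ, MvPolynomial.aeval (fun q : σ => algebraMap (MvPolynomial σ κ)
      (FractionRing (MvPolynomial σ κ)) (MvPolynomial.X q)) r = algebraMap _ _ r := fun r =>
    (DFunLike.congr_fun (MvPolynomial.aeval_unique
      (IsScalarTower.toAlgHom κ (MvPolynomial σ κ) (FractionRing (MvPolynomial σ κ)))) r).symm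
  exact (IntermediateField.mem_adjoin_range_iff _ _ _).mpr ⟨p, q, by rw [h, h]⟩

theorem exists_natCard_solutions {n s : ℕ} {v : Fin s → Fin n → ℤ} (κ : Type*) [Field κ]
    [IsAlgClosed κ] [CharZero κ]
    (hv : Submodule.span ℝ (Set.range fun j (l : Fin n) => (v j l : ℝ)) = ⊤) :
    ∃ D : MvPolynomial (Fin n ⊕ Fin n × Fin s) κ, D ≠ 0 ∧ ∀ c, MvPolynomial.eval c D ≠ 0 →
      {lam : Fin n → κˣ |
        ∀ i, c (.inl i) = ∑ j, c (.inr (i, j)) * ((mon lam (v j) : κˣ) : κ)}.Finite ∧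
      (Nat.card {lam : Fin n → κˣ |
        ∀ i, c (.inl i) = ∑ j, c (.inr (i, j)) * ((mon lam (v j) : κˣ) : κ)} : ℝ) =
      n.factorial * MeasureTheory.volume.real
        (convexHull ℝ (insert 0 (Set.range fun j (l : Fin n) => (v j l : ℝ)))) := by
  let L := FractionRing (MvPolynomial (Fin n ⊕ Fin n × Fin s) κ)
  let X : Fin n ⊕ Fin n × Fin s → L := fun q =>
    algebraMap (MvPolynomial (Fin n ⊕ Fin n × Fin s) κ) L (MvPolynomial.X q)
  have hX := algebraicIndependent_fractionRing_X (Fin n ⊕ Fin n × Fin s) κ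
  let x : Fin n → Lˣ := fun l => Units.mk0 (X (.inl l)) (hX.ne_zero _)
  let a : Fin n × Fin s → L := fun p => X (.inr p)
  have hxa : Sum.elim (fun l => (x l : L)) a = X := by
    funext q
    rcases q with l | p <;> rfl
  have hw : AlgebraicIndependent κ (Sum.elim (fun l => (x l : L)) a) := hxa ▸ hX
  have htop : IntermediateField.adjoin κ (Set.range (Sum.elim (fun l => (x l : L)) a)) = ⊤ :=
    hxa ▸ adjoin_fractionRing_X _ κ
  have := finiteDimensional_genericSum hw htop hv
  obtain ⟨D, hD, h⟩ := exists_natCard_solutions_eq_finrank hw htop hv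
  refine ⟨D, hD, fun c hc => ⟨?_, ?_⟩⟩
  · refine Set.finite_coe_iff.mp ?_
    exact Nat.finite_of_card_ne_zero (by rw [h c hc]; exact Module.finrank_pos.ne')
  · rw [h c hc, finrank_genericSum hw htop hv]

theorem sum_mul_mon_eq_zero_iff {κ : Type*} [Field κ] {n s : ℕ} (m : Fin (s + 1) → Fin n → ℤ)
    (b : Fin (s + 1) → κ) (lam : Fin n → κˣ) :
    ∑ j, b j * ((mon lam (m j) : κˣ) : κ) = 0 ↔
      -b 0 = ∑ j : Fin s, b j.succ * ((mon lam (m j.succ - m 0) : κˣ) : κ) := by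
  have h : ∑ j, b j * ((mon lam (m j) : κˣ) : κ) = ((mon lam (m 0) : κˣ) : κ) *
      (b 0 + ∑ j : Fin s, b j.succ * ((mon lam (m j.succ - m 0) : κˣ) : κ)) := by
    rw [Fin.sum_univ_succ, mul_add, Finset.mul_sum, mul_comm]
    congr 1
    refine Finset.sum_congr rfl fun j _ => ?_
    rw [mul_left_comm, ← Units.val_mul, ← mon_add, add_sub_cancel]
  rw [h, mul_eq_zero_iff_left (Units.ne_zero _), neg_eq_iff_add_eq_zero]

theorem exists_polynomial_eval_splitFirst {κ : Type*} [Field κ] {n s : ℕ}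
    {D : MvPolynomial (Fin n ⊕ Fin n × Fin s) κ} (hD : D ≠ 0) :
    ∃ E : MvPolynomial (Fin n × Fin (s + 1)) κ, E ≠ 0 ∧ ∀ c : Fin n → Fin (s + 1) → κ,
      MvPolynomial.eval (fun p => c p.1 p.2) E =
        MvPolynomial.eval (Sum.elim (fun i => -c i 0) fun p => c p.1 p.2.succ) D := by
  let φ : MvPolynomial (Fin n ⊕ Fin n × Fin s) κ →ₐ[κ] MvPolynomial (Fin n × Fin (s + 1)) κ :=
    MvPolynomial.aeval (Sum.elim (fun i => -MvPolynomial.X (i, 0))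
      fun p => MvPolynomial.X (p.1, p.2.succ))
  let ψ : MvPolynomial (Fin n × Fin (s + 1)) κ →ₐ[κ] MvPolynomial (Fin n ⊕ Fin n × Fin s) κ :=
    MvPolynomial.aeval fun p => Fin.cases (-MvPolynomial.X (.inl p.1))
      (fun j => MvPolynomial.X (.inr (p.1, j))) p.2
  have hψφ : ψ.comp φ = AlgHom.id κ _ := by
    ext q : 1
    rcases q with i | p <;> simp [φ, ψ]
  refine ⟨φ D, fun h => hD ?_, fun c => ?_⟩
  · rw [← AlgHom.id_apply (R := κ) D, ← hψφ, AlgHom.comp_apply, h, map_zero]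
  · have h : (MvPolynomial.aeval (R := κ) fun p : Fin n × Fin (s + 1) => c p.1 p.2).comp φ =
        MvPolynomial.aeval (Sum.elim (fun i => -c i 0) fun p => c p.1 p.2.succ) := by
      ext q
      rcases q with i | p <;> simp [φ]
    exact DFunLike.congr_fun h D

end Kushnirenko

/-- Kushnirenko's theorem (solution-count form): if Δ = conv(m₀,…,m_s) ⊂ ℝⁿ has
dimension n, then for generic coefficients the system Σⱼ c_{ij} λ^{mⱼ} = 0 (i=1,…,n)
has exactly n!·vol(Δ) solutions λ ∈ (ℂˣ)ⁿ. -/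
theorem stmt_9
    (n : ℕ) (hn : 0 < n) (s : ℕ)
    (m : Fin (s + 1) → Fin n → ℤ)
    (hdim : affineSpan ℝ
        (Set.range fun j : Fin (s + 1) => fun l : Fin n => ((m j l : ℤ) : ℝ)) = ⊤) :
    ∃ D : MvPolynomial (Fin n × Fin (s + 1)) ℂ, D ≠ 0 ∧
      ∀ c : Fin n → Fin (s + 1) → ℂ,
        MvPolynomial.eval (fun p => c p.1 p.2) D ≠ 0 →
          {lam : Fin n → ℂˣ |
              ∀ i, ∑ j, c i j * ((∏ l, lam l ^ m j l : ℂˣ) : ℂ) = 0}.Finite ∧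
          (Nat.card {lam : Fin n → ℂˣ |
              ∀ i, ∑ j, c i j * ((∏ l, lam l ^ m j l : ℂˣ) : ℂ) = 0} : ℝ)
            = (n.factorial : ℝ) *
              (MeasureTheory.volume (convexHull ℝ
                (Set.range fun j : Fin (s + 1) => fun l : Fin n => ((m j l : ℤ) : ℝ)))).toReal := by
  obtain ⟨D, hD, h⟩ := Kushnirenko.exists_natCard_solutions ℂ (Kushnirenko.span_sub_eq_top hdim)
  obtain ⟨E, hE, hED⟩ := Kushnirenko.exists_polynomial_eval_splitFirst hD
  refine ⟨E, hE, fun c hc => ?_⟩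
  have hset : {lam : Fin n → ℂˣ |
      ∀ i, ∑ j, c i j * ((∏ l, lam l ^ m j l : ℂˣ) : ℂ) = 0} =
      {lam : Fin n → ℂˣ | ∀ i, -c i 0 = ∑ j : Fin s, c i j.succ *
        ((Kushnirenko.mon lam (m j.succ - m 0) : ℂˣ) : ℂ)} :=
    Set.ext fun lam => forall_congr' fun i =>
      Kushnirenko.sum_mul_mon_eq_zero_iff m (c i) lam
  rw [hset, Kushnirenko.volume_convexHull_sub m]
  exact h _ (hED c ▸ hc)
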